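/- For all constants p ∈ (0,1) and q ∈ (0,1/2), there exist constants ε > 0 and C > 0 and a negligible function ν such that for all n ≥ 2 and all odd integers m ≥ C·n·(log n)^6: the probability, over a uniformly random x ∈ {0,1}^n and the internal randomness of the maps, that wt( x ⊕ MajDec_n( BSC_q( BDC_p( MajEnc_m(x) ) ) ) ) > (1/2 − ε)·n is at most ν(n). -/

import Mathlib

open Finset
open scoped Classical

/-- `ν : ℕ → ℝ` is negligible if for every `k`, `ν n ≤ n⁻ᵏ` for all sufficiently large `n`. -/
def Negligible (ν : ℕ → ℝ) : Prop :=
  ∀ k : ℕ, ∃ N : ℕ, ∀ n ≥ N, ν n ≤ 1 / (n : ℝ) ^ k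

/-- Majority of a list of bits, breaking a tie with the bit `tie`. -/
def majTie (blk : List Bool) (tie : Bool) : Bool :=
  if blk.length < 2 * (blk.filter id).length then true
  else if 2 * (blk.filter id).length < blk.length then false
  else tie

/-- Majority bit of a vector of bits (strict majority; when the length is odd no tie
can occur). -/
def majVec {m : ℕ} (y : Fin m → Bool) : Bool :=
  decide (m < 2 * (univ.filter (fun j => y j = true)).card)

/-- Concatenation of `n` blocks of length `m` into a single bitstring. -/
def concatBlocks (n m : ℕ) (y : Fin n → Fin m → Bool) : List Bool :=
  (List.ofFn (fun i : Fin n => List.ofFn (fun j : Fin m => y i j))).flatten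

/-- Delete the positions of `z` whose deletion flag (in `D`) is `true`, keeping the
surviving bits in order. -/
def applyDel (z D : List Bool) : List Bool :=
  ((z.zip D).filter (fun bd => bd.2 = false)).map Prod.fst

/-- Flip the bits of `z` according to the flip flags `f`. -/
def applyFlips (z f : List Bool) : List Bool :=
  (z.zip f).map (fun bf => xor bf.1 bf.2)

/-- The `i`-th of `nB` contiguous blocks of `z` (block lengths pairwise differ by at most 1). -/
def blockOf (nB : ℕ) (z : List Bool) (i : ℕ) : List Bool :=
  (z.drop (i * z.length / nB)).take ((i + 1) * z.length / nB - i * z.length / nB)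

/-- Majority decoder `MajDec`: partition `z` into `nB` contiguous blocks whose lengths
pairwise differ by at most 1 and output the blockwise majorities, breaking the tie in
block `i` with the coin `τ i`. -/
def majDec (nB : ℕ) (z : List Bool) (τ : Fin nB → Bool) (i : Fin nB) : Bool :=
  majTie (blockOf nB z i) (τ i)

/-- Number of `true` coordinates. -/
def countT {k : ℕ} (v : Fin k → Bool) : ℕ := (univ.filter (fun j => v j = true)).card

/-! ### Finite product expectations -/

/-- Expectation over independent bits with laws `w j`. -/
noncomputable def EE {ι : Type*} [Fintype ι] (w : ι → Bool → ℝ) (F : (ι → Bool) → ℝ) : ℝ :=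
  ∑ ω : ι → Bool, (∏ j, w j (ω j)) * F ω

/-- Bernoulli weight. -/
noncomputable def bw (p : ℝ) (b : Bool) : ℝ := if b = true then p else 1 - p

/-- probability weights -/
def IsPW {ι : Type*} (w : ι → Bool → ℝ) : Prop :=
  (∀ j b, 0 ≤ w j b) ∧ ∀ j, ∑ b, w j b = 1

lemma isPW_bw {ι : Type*} (p : ℝ) (h0 : 0 ≤ p) (h1 : p ≤ 1) :
    IsPW (fun _ : ι => bw p) := by
  refine ⟨fun j b => ?_, fun j => ?_⟩
  · cases b <;> simp [bw] <;> linarith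
  · simp [bw]

set_option linter.unusedSectionVars false

section EEbasic
variable {ι κ : Type*} [Fintype ι] [Fintype κ]

lemma EE_mono {w : ι → Bool → ℝ} (hw : IsPW w) {F G : (ι → Bool) → ℝ} (h : ∀ ω, F ω ≤ G ω) :
    EE w F ≤ EE w G := by
  unfold EE
  exact Finset.sum_le_sum fun ω _ =>
    mul_le_mul_of_nonneg_left (h ω) (Finset.prod_nonneg fun j _ => hw.1 j _)

lemma EE_add (w : ι → Bool → ℝ) (F G : (ι → Bool) → ℝ) :
    EE w (fun ω => F ω + G ω) = EE w F + EE w G := by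
  simp [EE, mul_add, Finset.sum_add_distrib]

lemma EE_sub (w : ι → Bool → ℝ) (F G : (ι → Bool) → ℝ) :
    EE w (fun ω => F ω - G ω) = EE w F - EE w G := by
  simp [EE, mul_sub, Finset.sum_sub_distrib]

lemma EE_smul (w : ι → Bool → ℝ) (c : ℝ) (F : (ι → Bool) → ℝ) :
    EE w (fun ω => c * F ω) = c * EE w F := by
  simp only [EE, Finset.mul_sum]
  exact Finset.sum_congr rfl fun ω _ => by ring

lemma EE_sum {α : Type*} (s : Finset α) (w : ι → Bool → ℝ) (F : α → (ι → Bool) → ℝ) :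
    EE w (fun ω => ∑ a ∈ s, F a ω) = ∑ a ∈ s, EE w (F a) := by
  simp only [EE, Finset.mul_sum]
  exact Finset.sum_comm

lemma EE_prod (w : ι → Bool → ℝ) (g : ι → Bool → ℝ) :
    EE w (fun ω => ∏ j, g j (ω j)) = ∏ j, ∑ b, w j b * g j b := by
  rw [Finset.prod_univ_sum]
  simp only [EE, Fintype.piFinset_univ, Finset.prod_mul_distrib]

lemma EE_const {w : ι → Bool → ℝ} (hw : IsPW w) (c : ℝ) : EE w (fun _ => c) = c := by
  have h := EE_prod w (fun _ _ => (1:ℝ))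
  simp only [mul_one, Finset.prod_const_one] at h
  have h2 := EE_smul w c (fun _ => (1:ℝ))
  simp only [mul_one] at h2
  rw [h2, h, Finset.prod_congr rfl (fun j _ => hw.2 j)]; simp

lemma EE_prod_subset {w : ι → Bool → ℝ} (hw : IsPW w) (A : Finset ι) (g : ι → Bool → ℝ) :
    EE w (fun ω => ∏ j ∈ A, g j (ω j)) = ∏ j ∈ A, ∑ b, w j b * g j b := by
  have h := EE_prod w (fun j b => if j ∈ A then g j b else 1)
  have e1 : ∀ ω : ι → Bool, ∏ j, (if j ∈ A then g j (ω j) else 1) = ∏ j ∈ A, g j (ω j) := by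
    intro ω; simp [Finset.prod_ite_mem]
  have e2 : ∀ j, ∑ b, w j b * (if j ∈ A then g j b else 1)
      = if j ∈ A then ∑ b, w j b * g j b else 1 := by
    intro j
    split_ifs with hj
    · rfl
    · simpa using hw.2 j
  simp only [e1, e2] at h
  rw [h]; simp [Finset.prod_ite_mem]

lemma EE_marg {w : ι → Bool → ℝ} (hw : IsPW w) (i : ι) (g : Bool → ℝ) :
    EE w (fun ω => g (ω i)) = ∑ b, w i b * g b := by
  have h := EE_prod_subset hw {i} (fun _ => g)
  simpa using h

lemma EE_sumElim (w₁ : ι → Bool → ℝ) (w₂ : κ → Bool → ℝ) (F : (ι ⊕ κ → Bool) → ℝ) :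
    EE (Sum.elim w₁ w₂) F = EE w₁ (fun a => EE w₂ (fun b => F (Sum.elim a b))) := by
  simp only [EE, Finset.mul_sum]
  have hsp := Fintype.sum_prod_type' (fun (a : ι → Bool) (b : κ → Bool) => (∏ j, w₁ j (a j)) *
    ((∏ j, w₂ j (b j)) * F (Sum.elim a b)))
  rw [← hsp]
  refine Finset.sum_equiv (Equiv.sumArrowEquivProdArrow ι κ Bool) (fun _ => by simp) ?_
  intro ω _
  have : Sum.elim (ω ∘ Sum.inl) (ω ∘ Sum.inr) = ω := Sum.elim_comp_inl_inr ω
  simp only [Equiv.sumArrowEquivProdArrow, Equiv.coe_fn_mk, Fintype.prod_sum_type, Sum.elim_inl,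
    Sum.elim_inr, this, Function.comp]
  ring

lemma isPW_sumElim {w₁ : ι → Bool → ℝ} {w₂ : κ → Bool → ℝ} (h₁ : IsPW w₁) (h₂ : IsPW w₂) :
    IsPW (Sum.elim w₁ w₂) := by
  constructor
  · rintro (j | j) b
    · exact h₁.1 j b
    · exact h₂.1 j b
  · rintro (j | j)
    · exact h₁.2 j
    · exact h₂.2 j

lemma EE_comm (w₁ : ι → Bool → ℝ) (w₂ : κ → Bool → ℝ) (F : (ι → Bool) → (κ → Bool) → ℝ) :
    EE w₁ (fun a => EE w₂ (fun b => F a b)) = EE w₂ (fun b => EE w₁ (fun a => F a b)) := by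
  simp only [EE, Finset.mul_sum]
  rw [Finset.sum_comm]
  exact Finset.sum_congr rfl fun a _ => Finset.sum_congr rfl fun b _ => by ring

/-- `F` depends only on coordinates in `A`. -/
def DepOn (A : Set ι) (F : (ι → Bool) → ℝ) : Prop :=
  ∀ ω ω', (∀ j ∈ A, ω j = ω' j) → F ω = F ω'

lemma EE_indep {w : ι → Bool → ℝ} (hw : IsPW w) (A B : Set ι) (hAB : Disjoint A B)
    {F G : (ι → Bool) → ℝ} (hF : DepOn A F) (hG : DepOn B G) :
    EE w (fun ω => F ω * G ω) = EE w F * EE w G := by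
  have h1 : EE w (fun ω => F ω * G ω) =
      EE w (fun ω => EE w (fun _ω' => F ω * G ω)) := by
    congr 1; ext ω; rw [EE_const hw]
  have h2 : EE w F * EE w G = EE w (fun ω => EE w (fun ω' => F ω * G ω')) := by
    rw [show EE w F * EE w G = EE w G * EE w F by ring, ← EE_smul]
    congr 1; ext ω; rw [EE_smul]; ring
  rw [h1, h2]
  simp only [EE, Finset.mul_sum]
  rw [← Fintype.sum_prod_type' (f := fun (a b : ι → Bool) => (∏ j, w j (a j)) *
    ((∏ j, w j (b j)) * (F a * G a))), ← Fintype.sum_prod_type' (f := fun (a b : ι → Bool) => (∏ j, w j (a j)) *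
    ((∏ j, w j (b j)) * (F a * G b)))]
  let φ : (ι → Bool) × (ι → Bool) → (ι → Bool) × (ι → Bool) := fun x =>
    (fun j => if j ∈ B then x.2 j else x.1 j, fun j => if j ∈ B then x.1 j else x.2 j)
  have hφ : Function.Involutive φ := by
    intro x
    ext j <;> simp only [φ] <;> split_ifs <;> rfl
  refine Fintype.sum_equiv hφ.toPerm _ _ ?_
  rintro ⟨a, b⟩
  have e1 : F (φ (a, b)).1 = F a := hF _ _ fun j hj => by
    have : j ∉ B := fun h => Set.disjoint_left.1 hAB hj h
    simp [φ, this]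
  have e2 : G (φ (a, b)).2 = G a := hG _ _ fun j hj => by simp [φ, hj]
  have e3 : (∏ j, w j ((φ (a, b)).1 j)) * (∏ j, w j ((φ (a, b)).2 j))
      = (∏ j, w j (a j)) * (∏ j, w j (b j)) := by
    rw [← Finset.prod_mul_distrib, ← Finset.prod_mul_distrib]
    refine Finset.prod_congr rfl fun j _ => ?_
    simp only [φ]; split_ifs <;> ring
  simp only [Function.Involutive.coe_toPerm, e1, e2]
  calc _ = ((∏ j, w j (a j)) * (∏ j, w j (b j))) * (F a * G a) := by ring
    _ = _ := by rw [← e3]; ring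

lemma DepOn_prod {α : Type*} (s : Finset α) (A : α → Set ι) (F : α → (ι → Bool) → ℝ)
    (h : ∀ a ∈ s, DepOn (A a) (F a)) : DepOn (⋃ a ∈ s, A a) (fun ω => ∏ a ∈ s, F a ω) := by
  intro ω ω' hω
  refine Finset.prod_congr rfl fun a ha => h a ha _ _ fun j hj => hω j ?_
  simp only [Set.mem_iUnion]; exact ⟨a, ha, hj⟩

lemma EE_indep_prod {α : Type*} {w : ι → Bool → ℝ} (hw : IsPW w) (s : Finset α)
    (A : α → Set ι) (F : α → (ι → Bool) → ℝ)
    (h : ∀ a ∈ s, DepOn (A a) (F a)) (hd : ∀ a ∈ s, ∀ b ∈ s, a ≠ b → Disjoint (A a) (A b)) :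
    EE w (fun ω => ∏ a ∈ s, F a ω) = ∏ a ∈ s, EE w (F a) := by
  classical
  induction s using Finset.induction_on with
  | empty => simp [EE_const hw]
  | insert a s ha ih =>
    simp only [Finset.prod_insert ha]
    rw [EE_indep hw (A a) (⋃ b ∈ s, A b) _ (h a (Finset.mem_insert_self _ _))
      (DepOn_prod s A F fun b hb => h b (Finset.mem_insert_of_mem hb)), ih]
    · exact fun b hb => h b (Finset.mem_insert_of_mem hb)
    · exact fun b hb c hc => hd b (Finset.mem_insert_of_mem hb) c (Finset.mem_insert_of_mem hc)
    · simp only [Set.disjoint_iUnion_right]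
      intro b hb
      exact hd a (Finset.mem_insert_self _ _) b (Finset.mem_insert_of_mem hb)
        (fun e => ha (e ▸ hb))

/-- Coordinatewise pushforward of two independent families. -/
lemma EE_map2 (w₁ w₂ w : Bool → ℝ) (h : Bool → Bool → Bool)
    (hw : ∀ g, ∑ a, ∑ b, w₁ a * w₂ b * (if h a b = g then 1 else 0) = w g)
    (G : (ι → Bool) → ℝ) :
    EE (fun _ => w) G = EE (fun _ => w₁) (fun K => EE (fun _ => w₂) (fun f =>
      G (fun j => h (K j) (f j)))) := by
  have e : ∀ K f : ι → Bool, G (fun j => h (K j) (f j)) =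
      ∑ g : ι → Bool, (∏ j, (if h (K j) (f j) = g j then (1:ℝ) else 0)) * G g := by
    intro K f
    rw [Finset.sum_eq_single (fun j => h (K j) (f j))]
    · simp
    · intro g _ hg
      obtain ⟨j, hj⟩ : ∃ j, h (K j) (f j) ≠ g j := by
        by_contra hcon; push Not at hcon; exact hg (funext fun j => (hcon j).symm)
      rw [Finset.prod_eq_zero (Finset.mem_univ j) (by simp [hj])]; simp
    · simp
  have key : ∀ g : ι → Bool, EE (fun _ : ι => w₁) (fun K => EE (fun _ : ι => w₂) (fun f =>
      ∏ j, (if h (K j) (f j) = g j then (1:ℝ) else 0))) = ∏ j, w (g j) := by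
    intro g
    have : ∀ K : ι → Bool, EE (fun _ : ι => w₂) (fun f =>
      ∏ j, (if h (K j) (f j) = g j then (1:ℝ) else 0)) =
        ∏ j, ∑ b, w₂ b * (if h (K j) b = g j then (1:ℝ) else 0) := fun K =>
      EE_prod (fun _ : ι => w₂) (fun j b => if h (K j) b = g j then (1:ℝ) else 0)
    simp only [this]
    rw [EE_prod (fun _ : ι => w₁) (fun j a => ∑ b, w₂ b * (if h a b = g j then (1:ℝ) else 0))]
    refine Finset.prod_congr rfl fun j _ => ?_
    rw [← hw (g j)]
    refine Finset.sum_congr rfl fun a _ => ?_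
    rw [Finset.mul_sum]
    exact Finset.sum_congr rfl fun b _ => by ring
  simp only [e]
  simp only [EE_sum, fun (g : ι → Bool) (H : (ι → Bool) → ℝ) =>
    show EE (fun _ : ι => w₂) (fun f => H f * G g) = G g * EE (fun _ : ι => w₂) H by
      rw [← EE_smul]; congr 1; ext; ring]
  simp only [EE_smul, key]
  simp only [EE]
  exact Finset.sum_congr rfl fun g _ => by ring

/-- invariance of the uniform law under involutions -/
lemma EE_unif_invol (φ : (ι → Bool) → (ι → Bool)) (hφ : Function.Involutive φ)
    (F : (ι → Bool) → ℝ) :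
    EE (fun _ => bw (1/2)) (fun ω => F (φ ω)) = EE (fun _ => bw (1/2)) F := by
  have hb : ∀ b, bw (1/2) b = 1/2 := by intro b; cases b <;> norm_num [bw]
  simp only [EE, hb]
  exact Fintype.sum_equiv hφ.toPerm _ _ fun ω => rfl

end EEbasic

/-! ### Spins -/

/-- The spin of a bit. -/
noncomputable def spin (b : Bool) : ℝ := if b = true then 1 else -1

lemma spin_not (b : Bool) : spin (!b) = - spin b := by cases b <;> simp [spin]
lemma spin_sq (b : Bool) : spin b * spin b = 1 := by cases b <;> simp [spin]

/-- Sign function with `sg 0 = 0`. -/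
noncomputable def sg (x : ℝ) : ℝ := if 0 < x then 1 else if x < 0 then -1 else 0

lemma sg_sym_bound (X Y Z : ℝ) :
    (if |Y| < |X| ∧ |Z| < |X| then (1:ℝ) else 0) ≤
      1/4 * ((sg (X + Y) + sg (X - Y)) * (sg (X + Z) + sg (X - Z))) := by
  have h1 : ∀ X Y : ℝ, 0 ≤ X → 0 ≤ sg (X + Y) + sg (X - Y) := by
    intro X Y hX; unfold sg; split_ifs <;> first | (exfalso; linarith) | norm_num
  have h2 : ∀ X Y : ℝ, |Y| < X → sg (X + Y) + sg (X - Y) = 2 := by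
    intro X Y h
    have := abs_lt.1 h
    unfold sg; rw [if_pos (by linarith), if_pos (by linarith)]; norm_num
  have h3 : ∀ X : ℝ, sg (-X) = - sg X := by
    intro X; unfold sg; split_ifs <;> first | (exfalso; linarith) | norm_num
  have main : ∀ X : ℝ, 0 ≤ X → (if |Y| < |X| ∧ |Z| < |X| then (1:ℝ) else 0) ≤
      1/4 * ((sg (X + Y) + sg (X - Y)) * (sg (X + Z) + sg (X - Z))) := by
    intro X hX
    split_ifs with h
    · rw [abs_of_nonneg hX] at h
      rw [h2 X Y h.1, h2 X Z h.2]; norm_num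
    · have := mul_nonneg (h1 X Y hX) (h1 X Z hX)
      linarith
  rcases le_total 0 X with hX | hX
  · exact main X hX
  · have := main (-X) (by linarith)
    rw [abs_neg, show -X + Y = -(X - Y) by ring, show -X - Y = -(X+Y) by ring,
      show -X + Z = -(X - Z) by ring, show -X - Z = -(X+Z) by ring, h3, h3, h3, h3] at this
    linarith

section LemA
variable {ι : Type*} [Fintype ι]

/-- spin sum over a finset -/
noncomputable def SS (A : Finset ι) (ω : ι → Bool) : ℝ := ∑ j ∈ A, spin (ω j)

/-- uniform expectation -/
noncomputable def EU (F : (ι → Bool) → ℝ) : ℝ := EE (fun _ => bw (1/2)) F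

lemma isPW_half : IsPW (fun _ : ι => bw (1/2)) := isPW_bw _ (by norm_num) (by norm_num)

/-- flip the coordinates in `A` -/
noncomputable def flipOn (A : Finset ι) (ω : ι → Bool) : ι → Bool := fun j => if j ∈ A then !(ω j) else ω j

lemma flipOn_invol (A : Finset ι) : Function.Involutive (flipOn A) := by
  intro ω; ext j; simp only [flipOn]; split_ifs <;> simp

lemma EU_flip (A : Finset ι) (F : (ι → Bool) → ℝ) : EU (fun ω => F (flipOn A ω)) = EU F :=
  EE_unif_invol _ (flipOn_invol A) F

lemma SS_flip_self (A : Finset ι) (ω : ι → Bool) : SS A (flipOn A ω) = - SS A ω := by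
  unfold SS
  rw [← Finset.sum_neg_distrib]
  exact Finset.sum_congr rfl fun j hj => by simp [flipOn, hj, spin_not]

lemma SS_flip_disj (A B : Finset ι) (h : Disjoint A B) (ω : ι → Bool) :
    SS B (flipOn A ω) = SS B ω := by
  unfold SS
  refine Finset.sum_congr rfl fun j hj => ?_
  have : j ∉ A := fun h' => Finset.disjoint_left.1 h h' hj
  simp [flipOn, this]

lemma DepOn_SS (A : Finset ι) (g : ℝ → ℝ) : DepOn (A : Set ι) (fun ω => g (SS A ω)) := by
  intro ω ω' h
  have : SS A ω = SS A ω' := Finset.sum_congr rfl fun j hj => by rw [h j hj]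
  simp only [this]

lemma EU_sq (A : Finset ι) : EU (fun ω => SS A ω ^ 2) = A.card := by
  have h : ∀ ω, SS A ω ^ 2 = ∑ j ∈ A, ∑ k ∈ A, spin (ω j) * spin (ω k) := by
    intro ω; rw [sq, SS, Finset.sum_mul_sum]
  have hjk : ∀ j k : ι, EU (fun ω => spin (ω j) * spin (ω k)) = if j = k then 1 else 0 := by
    intro j k
    split_ifs with e
    · subst e
      simp only [spin_sq]; exact EE_const isPW_half 1
    · have h1 := EU_flip {j} (fun ω => spin (ω j) * spin (ω k))
      have h2 : ∀ ω : ι → Bool, spin (flipOn {j} ω j) * spin (flipOn {j} ω k)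
          = (-1) * (spin (ω j) * spin (ω k)) := by
        intro ω
        simp [flipOn, Ne.symm e, spin_not]
      simp only [h2] at h1
      unfold EU at h1 ⊢
      rw [EE_smul] at h1; linarith
  simp only [h]
  unfold EU at hjk ⊢
  simp only [EE_sum, hjk]
  simp

lemma EU_exp (A : Finset ι) (l : ℝ) :
    EU (fun ω => Real.exp (l * SS A ω)) = Real.cosh l ^ A.card := by
  have h : ∀ ω, Real.exp (l * SS A ω) = ∏ j ∈ A, Real.exp (l * spin (ω j)) := by
    intro ω; rw [SS, Finset.mul_sum, Real.exp_sum]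
  simp only [h]
  unfold EU
  rw [EE_prod_subset isPW_half A (fun _ b => Real.exp (l * spin b)), Finset.prod_const]
  congr 1
  rw [Real.cosh_eq]; simp [bw, spin]; ring

lemma event_bound {X Y Z l t : ℝ} (hl : 0 ≤ l) (ht : 0 < t) :
    Real.exp (l * X) * (1 - (Y ^ 2 + Z ^ 2) / t ^ 2) - Real.exp (l * t) ≤
      Real.exp (l * X) * (if |Y| < |X| ∧ |Z| < |X| then (1:ℝ) else 0) := by
  have hX := Real.exp_pos (l * X)
  have hT := Real.exp_pos (l * t)
  have hfr : 0 ≤ (Y ^ 2 + Z ^ 2) / t ^ 2 := by positivity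
  split_ifs with h
  · nlinarith
  · by_cases h2 : t ^ 2 ≤ Y ^ 2 + Z ^ 2
    · have : 1 ≤ (Y ^ 2 + Z ^ 2) / t ^ 2 := by rw [le_div_iff₀ (by positivity)]; linarith
      nlinarith
    · push Not at h2
      have hY : |Y| < t := abs_lt_of_sq_lt_sq (by nlinarith [sq_nonneg Z]) ht.le
      have hZ : |Z| < t := abs_lt_of_sq_lt_sq (by nlinarith [sq_nonneg Y]) ht.le
      have hXt : X ≤ t := by
        by_contra hc
        push Not at hc
        have := le_abs_self X
        exact h ⟨by linarith, by linarith⟩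
      have : Real.exp (l * X) ≤ Real.exp (l * t) :=
        Real.exp_le_exp.2 (mul_le_mul_of_nonneg_left hXt hl)
      nlinarith

lemma lemA (U P Q : Finset ι) (hUP : Disjoint U P) (hUQ : Disjoint U Q) (hPQ : Disjoint P Q)
    (l t η : ℝ) (hl : 0 ≤ l) (ht : 0 < t) (hη : 0 < η) :
    4 * η * (Real.cosh l ^ U.card * (1 - ((P.card : ℝ) + Q.card) / t ^ 2) - Real.exp (l * t)
      - η * Real.cosh (2 * l) ^ U.card) ≤
    EU (fun ω => sg (SS U ω + SS P ω) * sg (SS U ω + SS Q ω)) := by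
  set ev : (ι → Bool) → ℝ := fun ω =>
    if |SS P ω| < |SS U ω| ∧ |SS Q ω| < |SS U ω| then (1:ℝ) else 0 with hev
  -- symmetrization
  have hsym : EU ev ≤ EU (fun ω => sg (SS U ω + SS P ω) * sg (SS U ω + SS Q ω)) := by
    set G : (ι → Bool) → ℝ := fun ω => sg (SS U ω + SS P ω) * sg (SS U ω + SS Q ω) with hG
    have f1 := EU_flip P G
    have f2 := EU_flip Q G
    have f3 := EU_flip P (fun ω => G (flipOn Q ω))
    rw [f2] at f3
    have e : EU (fun ω => 1/4 * ((sg (SS U ω + SS P ω) + sg (SS U ω - SS P ω)) *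
        (sg (SS U ω + SS Q ω) + sg (SS U ω - SS Q ω)))) = EU G := by
      have : ∀ ω, 1/4 * ((sg (SS U ω + SS P ω) + sg (SS U ω - SS P ω)) *
        (sg (SS U ω + SS Q ω) + sg (SS U ω - SS Q ω))) =
          1/4 * (G ω + G (flipOn P ω) + G (flipOn Q ω) + G (flipOn Q (flipOn P ω))) := by
        intro ω
        simp only [hG, SS_flip_self, SS_flip_disj P U hUP.symm, SS_flip_disj Q U hUQ.symm,
          SS_flip_disj P Q hPQ, SS_flip_disj Q P hPQ.symm]
        simp only [sub_eq_add_neg]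
        ring
      simp only [this]
      unfold EU at f1 f2 f3 ⊢
      rw [EE_smul, EE_add, EE_add, EE_add, f1, f2, f3]; ring
    rw [← e]
    exact EE_mono isPW_half fun ω => sg_sym_bound _ _ _
  -- tilted bound
  have h1 : Real.cosh l ^ U.card * (1 - ((P.card : ℝ) + Q.card) / t ^ 2) - Real.exp (l * t)
      ≤ EU (fun ω => Real.exp (l * SS U ω) * ev ω) := by
    have e1 : EU (fun ω => Real.exp (l * SS U ω) * (1 - (SS P ω ^ 2 + SS Q ω ^ 2) / t ^ 2)
        - Real.exp (l * t)) = Real.cosh l ^ U.card * (1 - ((P.card : ℝ) + Q.card) / t ^ 2)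
          - Real.exp (l * t) := by
      have i1 : EU (fun ω => Real.exp (l * SS U ω) * SS P ω ^ 2) =
          Real.cosh l ^ U.card * P.card := by
        rw [← EU_exp, ← EU_sq]
        exact EE_indep isPW_half _ _ (by exact_mod_cast hUP)
          (DepOn_SS U (fun x => Real.exp (l * x))) (DepOn_SS P (fun x => x ^ 2))
      have i2 : EU (fun ω => Real.exp (l * SS U ω) * SS Q ω ^ 2) =
          Real.cosh l ^ U.card * Q.card := by
        rw [← EU_exp, ← EU_sq]
        exact EE_indep isPW_half _ _ (by exact_mod_cast hUQ)
          (DepOn_SS U (fun x => Real.exp (l * x))) (DepOn_SS Q (fun x => x ^ 2))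
      have i0 := EU_exp U l
      have r : ∀ ω, Real.exp (l * SS U ω) * (1 - (SS P ω ^ 2 + SS Q ω ^ 2) / t ^ 2)
          - Real.exp (l * t) = Real.exp (l * SS U ω) - (1 / t ^ 2) *
          (Real.exp (l * SS U ω) * SS P ω ^ 2 + Real.exp (l * SS U ω) * SS Q ω ^ 2)
          - Real.exp (l * t) := by intro ω; ring
      simp only [r]
      unfold EU at i0 i1 i2 ⊢
      rw [EE_sub, EE_sub, EE_smul, EE_add, i0, i1, i2, EE_const isPW_half]; ring
    rw [← e1]
    exact EE_mono isPW_half fun ω => event_bound hl ht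
  have h2 : EU (fun ω => Real.exp (l * SS U ω) * ev ω) ≤
      η * Real.cosh (2 * l) ^ U.card + 1 / (4 * η) * EU ev := by
    rw [← EU_exp]
    unfold EU
    rw [← EE_smul, ← EE_smul, ← EE_add]
    refine EE_mono isPW_half fun ω => ?_
    have hx : Real.exp (2 * l * SS U ω) = Real.exp (l * SS U ω) ^ 2 := by
      rw [← Real.exp_nat_mul]; congr 1; push_cast; ring
    rw [hx]
    have : ev ω = 0 ∨ ev ω = 1 := by simp only [hev]; split_ifs <;> simp
    rcases this with h | h <;> rw [h]
    · simp; positivity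
    · have : η * Real.exp (l * SS U ω) ^ 2 + 1 / (4 * η) * 1 - Real.exp (l * SS U ω) * 1
        = η * (Real.exp (l * SS U ω) - 1 / (2 * η)) ^ 2 := by field_simp; ring
      have : 0 ≤ η * (Real.exp (l * SS U ω) - 1 / (2 * η)) ^ 2 := by positivity
      linarith
  have h3 : 4 * η * (1 / (4 * η) * EU ev) = EU ev := by field_simp
  have h4 := h1.trans h2
  have : 4 * η * (Real.cosh l ^ U.card * (1 - ((P.card : ℝ) + Q.card) / t ^ 2) - Real.exp (l * t)
      - η * Real.cosh (2 * l) ^ U.card) ≤ 4 * η * (1 / (4 * η) * EU ev) :=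
    mul_le_mul_of_nonneg_left (by linarith) (by positivity)
  linarith

end LemA

/-! ### Correlation of the majority of a block with the majority of its noisy shifted version -/

section Corr
variable {J Rk : Type*} [Fintype J] [Fintype Rk]

lemma EU_sumElim (F : (J ⊕ Rk → Bool) → ℝ) :
    EU F = EU (fun a : J → Bool => EU (fun b : Rk → Bool => F (Sum.elim a b))) := by
  unfold EU
  rw [← EE_sumElim]
  congr 1
  ext j; cases j <;> rfl

/-- xor each noise bit with the bit at its position -/
def twist (pos : Rk → J) (ω : J ⊕ Rk → Bool) : J ⊕ Rk → Bool :=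
  Sum.elim (fun j => ω (Sum.inl j)) (fun r => xor (ω (Sum.inr r)) (ω (Sum.inl (pos r))))

lemma twist_invol (pos : Rk → J) : Function.Involutive (twist pos) := by
  intro ω; ext j; cases j <;> simp [twist]

lemma corr_fixed (pos : Rk → J) (B : Finset J) (R : Finset Rk)
    (inj : ∀ r ∈ R, ∀ r' ∈ R, pos r = pos r' → r = r') (K : Rk → Bool)
    (m : ℕ) (hB : B.card ≤ m) (hR : R.card ≤ 2 * m) (hm : 0 < m)
    (l η : ℝ) (hl : 0 ≤ l) (hη : 0 < η) :
    4 * η * (Real.cosh l ^ (R.filter (fun r => K r = true ∧ pos r ∈ B)).card * (1/2)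
      - Real.exp (l * (3 * √m)) - η * Real.cosh (2 * l) ^ m) ≤
    EU (fun y : J → Bool => EU (fun f : Rk → Bool => sg (∑ j ∈ B, spin (y j)) *
      sg (∑ r ∈ R, spin (xor (y (pos r)) (!(K r) && f r))))) := by
  have hsm : 0 < √(m:ℝ) := Real.sqrt_pos.2 (by exact_mod_cast hm)
  let R1 := R.filter (fun r => K r = true ∧ pos r ∈ B)
  let R2 := R.filter (fun r => ¬ (K r = true ∧ pos r ∈ B))
  let v : Rk → J ⊕ Rk := fun r => if K r = true then Sum.inl (pos r) else Sum.inr r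
  have vinj : ∀ r ∈ R, ∀ r' ∈ R, v r = v r' → r = r' := by
    intro r hr r' hr' h
    simp only [v] at h
    split_ifs at h
    · exact inj r hr r' hr' (Sum.inl.inj h)
    · exact Sum.inr.inj h
  let U := R1.image v
  let B' : Finset (J ⊕ Rk) := B.image Sum.inl
  let P := B' \ U
  let Q := R2.image v
  have hUB : U ⊆ B' := by
    intro x hx
    obtain ⟨r, hr, rfl⟩ := Finset.mem_image.1 hx
    have := (Finset.mem_filter.1 hr).2
    simp only [v, this.1, if_true, B']
    exact Finset.mem_image_of_mem _ this.2
  have hUP : Disjoint U P := Finset.disjoint_sdiff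
  have hUQ : Disjoint U Q := by
    rw [Finset.disjoint_left]
    intro x hx hx'
    obtain ⟨r, hr, rfl⟩ := Finset.mem_image.1 hx
    obtain ⟨r', hr', h⟩ := Finset.mem_image.1 hx'
    have hr := Finset.mem_filter.1 hr
    have hr' := Finset.mem_filter.1 hr'
    have := vinj _ hr'.1 _ hr.1 h
    subst this
    exact hr'.2 hr.2
  have hPQ : Disjoint P Q := by
    rw [Finset.disjoint_left]
    intro x hx hx'
    obtain ⟨r, hr, rfl⟩ := Finset.mem_image.1 hx'
    have hr := Finset.mem_filter.1 hr
    obtain ⟨j, hj, h⟩ := Finset.mem_image.1 (Finset.mem_sdiff.1 hx).1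
    simp only [v] at h
    split_ifs at h with hK
    exact hr.2 ⟨hK, by rw [← Sum.inl.inj h]; exact hj⟩
  have hcU : U.card = R1.card := Finset.card_image_of_injOn (by
    intro r hr r' hr' h
    exact vinj r (Finset.mem_filter.1 hr).1 r' (Finset.mem_filter.1 hr').1 h)
  have hcB' : B'.card ≤ m := Finset.card_image_le.trans hB
  have hcP : P.card ≤ m := (Finset.card_le_card Finset.sdiff_subset).trans hcB'
  have hcQ : Q.card ≤ 2 * m :=
    Finset.card_image_le.trans ((Finset.card_le_card (Finset.filter_subset _ _)).trans hR)
  have hcUm : U.card ≤ m := (Finset.card_le_card hUB).trans hcB'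
  have e1 : ∀ ω, SS U ω + SS P ω = ∑ j ∈ B, spin (ω (Sum.inl j)) := by
    intro ω
    unfold SS
    rw [← Finset.sum_union hUP, Finset.union_sdiff_of_subset hUB, Finset.sum_image]
    intro a _ b _ h; exact Sum.inl.inj h
  have e2 : ∀ ω, SS U ω + SS Q ω = ∑ r ∈ R, spin (ω (v r)) := by
    intro ω
    unfold SS
    rw [Finset.sum_image, Finset.sum_image, Finset.sum_filter_add_sum_filter_not]
    · intro r hr r' hr' h
      exact vinj r (Finset.mem_filter.1 hr).1 r' (Finset.mem_filter.1 hr').1 h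
    · intro r hr r' hr' h
      exact vinj r (Finset.mem_filter.1 hr).1 r' (Finset.mem_filter.1 hr').1 h
  have key := lemA U P Q hUP hUQ hPQ l (3 * √m) η hl (by positivity) hη
  have e3 : EU (fun y : J → Bool => EU (fun f : Rk → Bool => sg (∑ j ∈ B, spin (y j)) *
      sg (∑ r ∈ R, spin (xor (y (pos r)) (!(K r) && f r))))) =
      EU (fun ω => sg (SS U ω + SS P ω) * sg (SS U ω + SS Q ω)) := by
    have a1 := EU_sumElim (fun ω : J ⊕ Rk → Bool => sg (∑ j ∈ B, spin (ω (Sum.inl j))) *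
      sg (∑ r ∈ R, spin (xor (ω (Sum.inl (pos r))) (!(K r) && ω (Sum.inr r)))))
    simp only [Sum.elim_inl, Sum.elim_inr] at a1
    rw [← a1]
    have a2 := EE_unif_invol (twist pos) (twist_invol pos)
      (fun ω : J ⊕ Rk → Bool => sg (∑ j ∈ B, spin (ω (Sum.inl j))) *
      sg (∑ r ∈ R, spin (xor (ω (Sum.inl (pos r))) (!(K r) && ω (Sum.inr r)))))
    unfold EU
    rw [← a2]
    congr 1
    ext ω
    rw [e1, e2]
    congr 2
    refine Finset.sum_congr rfl fun r _ => ?_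
    simp only [twist, Sum.elim_inl, Sum.elim_inr, v]
    cases K r <;> simp
    cases ω (Sum.inl (pos r)) <;> cases ω (Sum.inr r) <;> simp
  rw [e3]
  refine le_trans (mul_le_mul_of_nonneg_left ?_ (by positivity)) key
  have hc0 : 0 < Real.cosh l := Real.cosh_pos l
  have hc2 : 1 ≤ Real.cosh (2 * l) := Real.one_le_cosh _
  have b1 : Real.cosh (2 * l) ^ U.card ≤ Real.cosh (2 * l) ^ m := pow_le_pow_right₀ hc2 hcUm
  have b2 : (1:ℝ)/2 ≤ 1 - ((P.card : ℝ) + Q.card) / (3 * √m) ^ 2 := by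
    have : (3 * √(m:ℝ)) ^ 2 = 9 * m := by
      rw [mul_pow, Real.sq_sqrt (by positivity)]; norm_num
    rw [this]
    have hm' : (0:ℝ) < m := by exact_mod_cast hm
    have c1 : (P.card : ℝ) ≤ m := by exact_mod_cast hcP
    have c2 : (Q.card : ℝ) ≤ 2 * m := by exact_mod_cast hcQ
    have : ((P.card : ℝ) + Q.card) / (9 * m) ≤ 1/2 := by
      rw [div_le_iff₀ (by positivity)]; linarith
    linarith
  have b3 := mul_le_mul_of_nonneg_left b2 (pow_pos hc0 U.card).le
  have b4 := mul_le_mul_of_nonneg_left b1 hη.le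
  rw [show (R.filter (fun r => K r = true ∧ pos r ∈ B)).card = U.card from hcU.symm]
  linarith

lemma cosh_lower (l : ℝ) : 1 + l ^ 2 / 2 ≤ Real.cosh l := by
  have h := Real.cosh_sq' (l/2)
  have h2 := Real.cosh_two_mul (l/2)
  rw [show 2 * (l/2) = l by ring] at h2
  have h3 : (l/2)^2 ≤ Real.sinh (l/2) ^ 2 := by
    rw [sq_le_sq]
    rcases le_total 0 (l/2) with h | h
    · rw [abs_of_nonneg h, abs_of_nonneg (Real.sinh_nonneg_iff.2 h)]
      exact Real.self_le_sinh_iff.2 h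
    · rw [abs_of_nonpos h, abs_of_nonpos (Real.sinh_nonpos_iff.2 h)]
      have := Real.sinh_le_self_iff.2 h
      linarith
  nlinarith

lemma exp_half_le {u : ℝ} (h0 : 0 ≤ u) (h1 : u ≤ 1) : Real.exp (u/2) ≤ 1 + u := by
  have h := Real.abs_exp_sub_one_sub_id_le (x := u/2) (by rw [abs_of_nonneg (by linarith)]; linarith)
  have := (abs_le.1 h).2
  nlinarith

lemma corr (q c s : ℝ) (hq1 : 0 < q) (hq2 : q < 1/2) (hs : 0 < s)
    (hs2 : 3 * s + 2 ≤ (1 - 2 * q) * c / 4 * s ^ 2)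
    (pos : Rk → J) (B : Finset J) (R : Finset Rk)
    (inj : ∀ r ∈ R, ∀ r' ∈ R, pos r = pos r' → r = r')
    (m : ℕ) (hB : B.card ≤ m) (hR : R.card ≤ 2 * m) (hm : 0 < m) (hsm : s ^ 2 ≤ m)
    (hT : c * m ≤ (R.filter (fun r => pos r ∈ B)).card) :
    Real.exp (-(2 * s ^ 2)) ≤
    EE (fun _ : J => bw (1/2)) (fun y => EE (fun _ : Rk => bw q) (fun f =>
      sg (∑ j ∈ B, spin (y j)) * sg (∑ r ∈ R, spin (xor (y (pos r)) (f r))))) := by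
  have hm' : (0:ℝ) < m := by exact_mod_cast hm
  have hsq : 0 < √(m:ℝ) := Real.sqrt_pos.2 hm'
  have hsqq : √(m:ℝ) ^ 2 = m := Real.sq_sqrt hm'.le
  set l := s / √(m:ℝ) with hldef
  have hl : 0 ≤ l := by positivity
  have hl2 : l ^ 2 * m = s ^ 2 := by rw [hldef, div_pow, hsqq]; field_simp
  have hl2' : l ^ 2 ≤ 1 := by
    by_contra hc; push Not at hc; nlinarith
  set η := Real.exp (-(2 * s ^ 2)) / 2 with hη
  have hη0 : 0 < η := by positivity
  have hqpw : IsPW (fun _ : Rk => bw (1 - 2 * q)) := isPW_bw _ (by linarith) (by linarith)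
  have step1 : ∀ G : (Rk → Bool) → ℝ, EE (fun _ : Rk => bw q) G =
      EE (fun _ : Rk => bw (1 - 2 * q)) (fun K => EE (fun _ : Rk => bw (1/2)) (fun f =>
        G (fun r => !(K r) && f r))) := by
    intro G
    refine EE_map2 (bw (1 - 2*q)) (bw (1/2)) (bw q) (fun a b => !a && b) ?_ G
    intro g
    cases g <;> simp [bw] <;> ring
  simp only [step1]
  rw [EE_comm]
  have step2 : EE (fun _ : Rk => bw (1 - 2 * q)) (fun K =>
      (2 * η) * (Real.cosh l ^ (R.filter (fun r => K r = true ∧ pos r ∈ B)).card) +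
       -(4 * η * (Real.exp (l * (3 * √m)) + η * Real.cosh (2 * l) ^ m))) ≤
      EE (fun _ : Rk => bw (1 - 2 * q)) (fun K => EE (fun _ : J => bw (1/2)) (fun y =>
        EE (fun _ : Rk => bw (1/2)) (fun f =>
        sg (∑ j ∈ B, spin (y j)) * sg (∑ r ∈ R, spin (xor (y (pos r)) (!(K r) && f r)))))) := by
    refine EE_mono hqpw fun K => ?_
    refine le_trans (le_of_eq ?_) (corr_fixed pos B R inj K m hB hR hm l η hl hη0)
    ring
  refine le_trans ?_ step2
  rw [EE_add, EE_smul, EE_const hqpw]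
  set T := R.filter (fun r => pos r ∈ B) with hTdef
  have hcosh : EE (fun _ : Rk => bw (1 - 2 * q)) (fun K =>
      Real.cosh l ^ (R.filter (fun r => K r = true ∧ pos r ∈ B)).card) =
      (2 * q + (1 - 2 * q) * Real.cosh l) ^ T.card := by
    have e : ∀ K : Rk → Bool, Real.cosh l ^ (R.filter (fun r => K r = true ∧ pos r ∈ B)).card =
        ∏ r ∈ T, (if K r = true then Real.cosh l else 1) := by
      intro K
      rw [Finset.prod_ite, Finset.prod_const, Finset.prod_const_one, mul_one, hTdef,
        Finset.filter_filter]
      congr 2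
      ext r; simp [and_comm]
    simp only [e]
    rw [EE_prod_subset hqpw T (fun _ b => if b = true then Real.cosh l else 1), Finset.prod_const]
    congr 1
    simp [bw]; ring
  rw [hcosh]
  have hlow : Real.exp (3 * s + 2) ≤ (2 * q + (1 - 2 * q) * Real.cosh l) ^ T.card := by
    have h1 : Real.exp ((1 - 2*q) * l^2/2/2) ≤ 2 * q + (1 - 2 * q) * Real.cosh l := by
      refine (exp_half_le (by have : 0 ≤ 1 - 2*q := by linarith
                              positivity) (by nlinarith)).trans ?_
      have := cosh_lower l
      nlinarith
    refine le_trans ?_ (pow_le_pow_left₀ (Real.exp_pos _).le h1 _)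
    rw [← Real.exp_nat_mul]
    refine Real.exp_le_exp.2 (hs2.trans ?_)
    rw [← hl2]
    have h0 : 0 ≤ (1 - 2*q) * l^2/2/2 := by
      have : 0 ≤ 1 - 2*q := by linarith
      positivity
    have := mul_le_mul_of_nonneg_right hT h0
    linarith
  have hlt : l * (3 * √(m:ℝ)) = 3 * s := by rw [hldef]; field_simp
  have hc2 : η * Real.cosh (2 * l) ^ m ≤ 1/2 := by
    have h1 : Real.cosh (2 * l) ^ m ≤ Real.exp (2 * s^2) := by
      refine (pow_le_pow_left₀ (Real.cosh_pos _).le (Real.cosh_le_exp_half_sq _) _).trans ?_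
      rw [← Real.exp_nat_mul]
      refine Real.exp_le_exp.2 ?_
      nlinarith
    refine (mul_le_mul_of_nonneg_left h1 hη0.le).trans ?_
    rw [hη, div_mul_eq_mul_div, ← Real.exp_add]; simp
  rw [hlt]
  have h4 : 4 * Real.exp (3 * s) ≤ Real.exp (3 * s + 2) := by
    rw [Real.exp_add, mul_comm]
    refine mul_le_mul_of_nonneg_left ?_ (Real.exp_pos _).le
    have : Real.exp 2 = Real.exp 1 ^ 2 := by rw [← Real.exp_nat_mul]; norm_num
    rw [this]
    have := Real.exp_one_gt_d9
    nlinarith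
  have h5 : 1 ≤ Real.exp (3 * s) := Real.one_le_exp (by linarith)
  have h6 : Real.exp (-(2 * s ^ 2)) = 2 * η := by rw [hη]; ring
  rw [h6]
  have h7 : 2 + 2 * Real.exp (3 * s) ≤ (2 * q + (1 - 2 * q) * Real.cosh l) ^ T.card := by linarith
  have h8 := mul_le_mul_of_nonneg_left h7 (by positivity : 0 ≤ 2 * η)
  have h9 := mul_le_mul_of_nonneg_left hc2 (by positivity : 0 ≤ 4 * η)
  nlinarith

end Corr

/-! ### Concentration of locally dependent signs -/

section Conc
variable {ι : Type*} [Fintype ι]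

lemma sign_mgf {w : ι → Bool → ℝ} (hw : IsPW w) (u : (ι → Bool) → ℝ)
    (hu : ∀ ω, u ω = 1 ∨ u ω = -1) (δ : ℝ) (h0 : 0 < δ) (h1 : δ ≤ 1) (hE : δ ≤ EE w u) :
    EE w (fun ω => Real.exp (-(δ/4) * (u ω - δ/2))) ≤ Real.exp (-(δ^2/16)) := by
  have e : ∀ ω, Real.exp (-(δ/4) * (u ω - δ/2)) =
      Real.exp (δ^2/8) * (Real.cosh (δ/4) - Real.sinh (δ/4) * u ω) := by
    intro ω
    rw [show -(δ/4) * (u ω - δ/2) = δ^2/8 + -(δ/4) * u ω by ring, Real.exp_add]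
    congr 1
    rcases hu ω with h | h <;> rw [h]
    · rw [mul_one, mul_one, Real.cosh_sub_sinh]
    · rw [mul_neg, mul_neg, mul_one, mul_one, neg_neg, sub_neg_eq_add, Real.cosh_add_sinh]
  simp only [e]
  rw [EE_smul, EE_sub, EE_const hw, EE_smul]
  have hs : δ/4 ≤ Real.sinh (δ/4) := Real.self_le_sinh_iff.2 (by linarith)
  have hc : Real.cosh (δ/4) ≤ 1 + (δ/4)^2 :=
    (Real.cosh_le_exp_half_sq _).trans (exp_half_le (by positivity) (by nlinarith))
  have h2 : δ/4 * δ ≤ Real.sinh (δ/4) * EE w u :=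
    mul_le_mul hs hE h0.le (by linarith)
  have h3 : Real.cosh (δ/4) - Real.sinh (δ/4) * EE w u ≤ Real.exp (-(3 * δ^2/16)) := by
    have := Real.add_one_le_exp (-(3 * δ^2/16))
    nlinarith
  refine (mul_le_mul_of_nonneg_left h3 (Real.exp_pos _).le).trans ?_
  rw [← Real.exp_add]
  exact Real.exp_le_exp.2 (by linarith)

lemma card_parity (n b : ℕ) (hb : b < 2) :
    n / 2 ≤ (univ.filter (fun i : Fin n => (i:ℕ) % 2 = b)).card := by
  have : (univ : Finset (Fin (n/2))).card ≤
      (univ.filter (fun i : Fin n => (i:ℕ) % 2 = b)).card := by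
    refine Finset.card_le_card_of_injOn
      (fun k : Fin (n/2) => (⟨2 * k + b, by have := k.2; omega⟩ : Fin n)) ?_ ?_
    · intro k _
      simp; omega
    · intro k _ k' _ h
      have := congrArg Fin.val h
      ext; simp at this; omega
  simpa using this

lemma conc {w : ι → Bool → ℝ} (hw : IsPW w) (n : ℕ) (hn : 2 ≤ n) (u : Fin n → (ι → Bool) → ℝ)
    (hu : ∀ i ω, u i ω = 1 ∨ u i ω = -1) (δ : ℝ) (h0 : 0 < δ) (h1 : δ ≤ 1)
    (hE : ∀ i, δ ≤ EE w (u i)) (A : Fin n → Set ι) (hA : ∀ i, DepOn (A i) (u i))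
    (hd : ∀ i i' : Fin n, i ≠ i' → (i:ℕ) % 2 = (i':ℕ) % 2 → Disjoint (A i) (A i')) :
    EE w (fun ω => if ∑ i, u i ω < δ/2 * n then (1:ℝ) else 0) ≤
      2 * Real.exp (-(δ^2/64 * n)) := by
  let I : ℕ → Finset (Fin n) := fun b => univ.filter (fun i : Fin n => (i:ℕ) % 2 = b)
  have hb : ∀ b < 2, EE w (fun ω => ∏ i ∈ I b, Real.exp (-(δ/4) * (u i ω - δ/2))) ≤
      Real.exp (-(δ^2/64 * n)) := by
    intro b hb
    rw [EE_indep_prod hw (I b) A (fun i ω => Real.exp (-(δ/4) * (u i ω - δ/2)))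
      (fun i _ ω ω' h => by simp only [hA i ω ω' h])
      (fun i hi j hj hij => hd i j hij (by
        rw [(Finset.mem_filter.1 hi).2, (Finset.mem_filter.1 hj).2]))]
    refine (Finset.prod_le_prod (fun i _ => ?_) (fun i _ =>
      sign_mgf hw (u i) (hu i) δ h0 h1 (hE i))).trans ?_
    · rw [← EE_const hw 0]
      exact EE_mono hw fun ω => (Real.exp_pos _).le
    · rw [Finset.prod_const, ← Real.exp_nat_mul]
      refine Real.exp_le_exp.2 ?_
      have hc := card_parity n b hb
      have hc' : (n:ℝ)/4 ≤ ((I b).card : ℝ) := by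
        have : n ≤ 4 * (I b).card := by
          have : n / 2 ≤ (I b).card := hc
          omega
        have : (n:ℝ) ≤ 4 * ((I b).card : ℝ) := by exact_mod_cast this
        linarith
      nlinarith [sq_nonneg δ]
  have hpt : ∀ ω, (if ∑ i, u i ω < δ/2 * n then (1:ℝ) else 0) ≤
      ∏ i ∈ I 0, Real.exp (-(δ/4) * (u i ω - δ/2)) +
      ∏ i ∈ I 1, Real.exp (-(δ/4) * (u i ω - δ/2)) := by
    intro ω
    simp only [← Real.exp_sum, ← Finset.mul_sum]
    split_ifs with h
    · have hsum : ∑ i ∈ I 0, (u i ω - δ/2) + ∑ i ∈ I 1, (u i ω - δ/2) = ∑ i, u i ω - δ/2 * n := by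
        have hI : I 1 = univ.filter (fun i : Fin n => ¬ (i:ℕ) % 2 = 0) := by
          ext i; simp [I]
        rw [hI, Finset.sum_filter_add_sum_filter_not, Finset.sum_sub_distrib]
        simp; ring
      have hp0 := Real.exp_pos (-(δ/4) * ∑ i ∈ I 0, (u i ω - δ/2))
      have hp1 := Real.exp_pos (-(δ/4) * ∑ i ∈ I 1, (u i ω - δ/2))
      by_cases hc : ∑ i ∈ I 0, (u i ω - δ/2) ≤ 0
      · have := Real.one_le_exp (x := -(δ/4) * ∑ i ∈ I 0, (u i ω - δ/2)) (by nlinarith)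
        linarith
      · have := Real.one_le_exp (x := -(δ/4) * ∑ i ∈ I 1, (u i ω - δ/2)) (by nlinarith)
        linarith
    · positivity
  refine (EE_mono hw hpt).trans ?_
  rw [EE_add]
  have := hb 0 (by norm_num)
  have := hb 1 (by norm_num)
  linarith

end Conc

/-! ### Deletion counts -/

/-- number of survivors among the first `t` positions -/
noncomputable def cnt {N : ℕ} (D : Fin N → Bool) (t : ℕ) : ℕ :=
  (univ.filter (fun k : Fin N => (k:ℕ) < t ∧ D k = false)).card

lemma cnt_tail {N : ℕ} (p : ℝ) (hp1 : 0 < p) (hp2 : p < 1) (t : ℕ) (ht : t ≤ N) (σ x θ : ℝ)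
    (hσ : σ = 1 ∨ σ = -1) (hθ0 : 0 ≤ θ) (hθ1 : θ ≤ 1) :
    EE (fun _ : Fin N => bw p) (fun D => if x < σ * (cnt D t - (1 - p) * t) then (1:ℝ) else 0) ≤
      Real.exp (N * θ^2 - θ * x) := by
  have hw : IsPW (fun _ : Fin N => bw p) := isPW_bw p hp1.le hp2.le
  let T : Finset (Fin N) := univ.filter (fun k : Fin N => (k:ℕ) < t)
  have hT : T.card = t := by
    simp only [T]
    rw [Fin.card_filter_val_lt]; omega
  let g : Bool → ℝ := fun b => Real.exp (θ * σ * ((if b = false then 1 else 0) - (1 - p)))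
  have hS : ∀ D : Fin N → Bool, (cnt D t : ℝ) - (1 - p) * t =
      ∑ k ∈ T, ((if D k = false then (1:ℝ) else 0) - (1 - p)) := by
    intro D
    rw [Finset.sum_sub_distrib, Finset.sum_const, hT, ← Finset.sum_filter, Finset.sum_const,
      Finset.filter_filter]
    simp [cnt]; ring
  have hpt : ∀ D : Fin N → Bool, (if x < σ * (cnt D t - (1 - p) * t) then (1:ℝ) else 0) ≤
      Real.exp (-(θ * x)) * ∏ k ∈ T, g (D k) := by
    intro D
    simp only [g]
    rw [← Real.exp_sum, ← Finset.mul_sum, ← hS, ← Real.exp_add]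
    split_ifs with h
    · refine Real.one_le_exp ?_
      nlinarith
    · positivity
  refine (EE_mono hw hpt).trans ?_
  rw [EE_smul, EE_prod_subset hw T (fun _ => g), Finset.prod_const, hT]
  have hg : ∑ b, bw p b * g b ≤ Real.exp (θ^2) := by
    have hσ2 : σ ^ 2 = 1 := by rcases hσ with h | h <;> rw [h] <;> norm_num
    have hσa : |σ| = 1 := by rcases hσ with h | h <;> rw [h] <;> norm_num
    have b1 : ∀ v : ℝ, |v| ≤ 1 → Real.exp (θ * σ * v) ≤ 1 + θ * σ * v + θ^2 * v^2 := by
      intro v hv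
      have h := Real.abs_exp_sub_one_sub_id_le (x := θ * σ * v) (by
        rw [abs_mul, abs_mul, hσa, abs_of_nonneg hθ0]; nlinarith [abs_nonneg v])
      have := (abs_le.1 h).2
      have e : (θ * σ * v)^2 = θ^2 * v^2 := by rw [mul_pow, mul_pow, hσ2]; ring
      linarith
    have c1 := b1 (0 - (1-p)) (by rw [abs_le]; constructor <;> linarith)
    have c2 := b1 (1 - (1-p)) (by rw [abs_le]; constructor <;> linarith)
    have : ∑ b, bw p b * g b = p * Real.exp (θ * σ * (0 - (1-p))) +
        (1 - p) * Real.exp (θ * σ * (1 - (1-p))) := by simp [bw, g]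
    rw [this]
    have d1 := mul_le_mul_of_nonneg_left c1 hp1.le
    have d2 := mul_le_mul_of_nonneg_left c2 (by linarith : 0 ≤ 1 - p)
    have d3 := Real.add_one_le_exp (θ^2)
    have d4 : p * (1-p) * θ^2 ≤ θ^2 := by nlinarith [sq_nonneg θ, mul_pos hp1 (by linarith : 0 < 1 - p)]
    nlinarith
  have hg0 : 0 ≤ ∑ b, bw p b * g b :=
    Finset.sum_nonneg fun b _ => mul_nonneg
      ((isPW_bw (ι := Unit) p hp1.le hp2.le).1 () b) (Real.exp_pos _).le
  calc _ ≤ Real.exp (-(θ*x)) * Real.exp (θ^2) ^ t :=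
        mul_le_mul_of_nonneg_left (pow_le_pow_left₀ hg0 hg _) (Real.exp_pos _).le
    _ = Real.exp (t * θ^2 - θ * x) := by
        rw [← Real.exp_nat_mul, ← Real.exp_add]; congr 1; ring
    _ ≤ _ := by
        refine Real.exp_le_exp.2 ?_
        have : (t:ℝ) ≤ N := by exact_mod_cast ht
        nlinarith [sq_nonneg θ]

lemma bad_bound (n m : ℕ) (hn : 2 ≤ n) (p : ℝ) (hp1 : 0 < p) (hp2 : p < 1) (a : ℝ)
    (ha : 0 < a) (ha1 : a ≤ 1) :
    EE (fun _ : Fin (n * m) => bw p) (fun D =>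
      if ∀ i ≤ n, |(cnt D (i * m) : ℝ) - (1 - p) * (i * m)| ≤ a * m then (0:ℝ) else 1) ≤
      2 * (n + 1) * Real.exp (-(a^2 / 4 * (m / n))) := by
  have hw : IsPW (fun _ : Fin (n*m) => bw p) := isPW_bw p hp1.le hp2.le
  have hn' : (2:ℝ) ≤ n := by exact_mod_cast hn
  have hpt : ∀ D : Fin (n*m) → Bool,
      (if ∀ i ≤ n, |(cnt D (i * m) : ℝ) - (1 - p) * (i * m)| ≤ a * m then (0:ℝ) else 1) ≤
      ∑ i ∈ Finset.range (n+1),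
        ((if a * m < 1 * ((cnt D (i*m) : ℝ) - (1 - p) * ((i*m : ℕ) : ℝ)) then (1:ℝ) else 0) +
         (if a * m < (-1) * ((cnt D (i*m) : ℝ) - (1 - p) * ((i*m : ℕ) : ℝ)) then (1:ℝ) else 0)) := by
    intro D
    have hnn : ∀ i ∈ Finset.range (n+1), (0:ℝ) ≤
        ((if a * m < 1 * ((cnt D (i*m) : ℝ) - (1 - p) * ((i*m : ℕ) : ℝ)) then (1:ℝ) else 0) +
         (if a * m < (-1) * ((cnt D (i*m) : ℝ) - (1 - p) * ((i*m : ℕ) : ℝ)) then (1:ℝ) else 0)) := by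
      intro i _; split_ifs <;> norm_num
    split_ifs with h
    · exact Finset.sum_nonneg hnn
    · push Not at h
      obtain ⟨i, hi, h⟩ := h
      refine le_trans ?_ (Finset.single_le_sum hnn (Finset.mem_range.2 (by omega : i < n + 1)))
      push_cast
      rcases lt_abs.1 h with h' | h'
      · rw [if_pos (by linarith)]; split_ifs <;> norm_num
      · rw [if_pos (c := a * m < (-1) * _) (by linarith)]; split_ifs <;> norm_num
  refine (EE_mono hw hpt).trans ?_
  rw [EE_sum]
  simp only [EE_add]
  have hθ1 : a / (2 * n) ≤ 1 := by rw [div_le_iff₀ (by positivity)]; linarith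
  have hexp : ((n * m : ℕ) : ℝ) * (a / (2*n))^2 - a / (2*n) * (a * m) = -(a^2 / 4 * (m / n)) := by
    push_cast; field_simp; ring
  have hterm : ∀ i ∈ Finset.range (n+1), ∀ σ : ℝ, (σ = 1 ∨ σ = -1) →
      EE (fun _ : Fin (n * m) => bw p) (fun D =>
        if a * m < σ * ((cnt D (i*m) : ℝ) - (1 - p) * ((i*m : ℕ) : ℝ)) then (1:ℝ) else 0) ≤
      Real.exp (-(a^2 / 4 * (m / n))) := by
    intro i hi σ hσ
    have := cnt_tail (N := n * m) p hp1 hp2 (i * m)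
      (Nat.mul_le_mul_right _ (by have := Finset.mem_range.1 hi; omega)) σ (a * m) (a / (2*n)) hσ
      (by positivity) hθ1
    rw [hexp] at this
    exact this
  refine (Finset.sum_le_sum fun i hi => add_le_add (hterm i hi 1 (Or.inl rfl))
    (hterm i hi (-1) (Or.inr rfl))).trans ?_
  simp; apply le_of_eq; ring

/-! ### The list side -/

/-- surviving positions -/
def surv {N : ℕ} (D : Fin N → Bool) : List (Fin N) :=
  (List.finRange N).filter (fun k => D k = false)

/-- position of the `r`-th survivor -/
def posF {N : ℕ} (D : Fin N → Bool) (r : Fin N) : Fin N :=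
  if h : (r:ℕ) < (surv D).length then (surv D)[(r:ℕ)] else r

lemma applyDel_map {N : ℕ} (Y D : Fin N → Bool) (l : List (Fin N)) :
    applyDel (l.map Y) (l.map D) = (l.filter (fun k => D k = false)).map Y := by
  unfold applyDel
  induction l with
  | nil => simp
  | cons a l ih =>
    cases h : D a <;> simp_all

lemma surv_length_le {N : ℕ} (D : Fin N → Bool) : (surv D).length ≤ N := by
  refine (List.length_filter_le _ _).trans ?_
  simp

lemma posF_inj {N : ℕ} (D : Fin N → Bool) (r r' : Fin N) (hr : (r:ℕ) < (surv D).length)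
    (hr' : (r':ℕ) < (surv D).length) (h : posF D r = posF D r') : r = r' := by
  simp only [posF, hr, hr', dif_pos] at h
  have hn : (surv D).Nodup := (List.nodup_finRange N).filter _
  exact Fin.ext ((List.Nodup.getElem_inj_iff hn).1 h)

lemma sorted_rank {N : ℕ} (t : ℕ) (l : List (Fin N)) (hl : l.Pairwise (· < ·)) (r : ℕ)
    (hr : r < l.length) :
    ((l[r] : Fin N) : ℕ) < t ↔ r < (l.filter (fun k : Fin N => decide ((k:ℕ) < t))).length := by
  induction l generalizing r with
  | nil => simp at hr
  | cons a l ih =>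
    rw [List.pairwise_cons] at hl
    by_cases ha : (a:ℕ) < t
    · rw [List.filter_cons_of_pos (by simpa using ha)]
      cases r with
      | zero => simp [ha]
      | succ r =>
        simp only [List.getElem_cons_succ, List.length_cons]
        rw [ih hl.2 r (by simpa using hr)]; omega
    · rw [List.filter_cons_of_neg (by simpa using ha)]
      have hall : ∀ x ∈ l, ¬ ((x:ℕ) < t) := by
        intro x hx h
        have : (a:ℕ) < x := hl.1 x hx
        omega
      have : l.filter (fun k : Fin N => decide ((k:ℕ) < t)) = [] := by
        rw [List.filter_eq_nil_iff]; intro x hx; simpa using hall x hx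
      rw [this]
      simp only [List.length_nil, Nat.not_lt_zero, iff_false]
      cases r with
      | zero => simpa using ha
      | succ r => simpa using hall _ (List.getElem_mem _)

lemma filter_length_cnt {N : ℕ} (D : Fin N → Bool) (t : ℕ) :
    ((surv D).filter (fun k : Fin N => decide ((k:ℕ) < t))).length = cnt D t := by
  unfold surv cnt
  rw [List.filter_filter, ← List.toFinset_card_of_nodup ((List.nodup_finRange N).filter _)]
  congr 1
  ext k; simp

lemma posF_lt_iff {N : ℕ} (D : Fin N → Bool) (r : Fin N) (hr : (r:ℕ) < (surv D).length) (t : ℕ) :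
    (posF D r : ℕ) < t ↔ (r:ℕ) < cnt D t := by
  rw [← filter_length_cnt, ← sorted_rank t (surv D) _ _ hr]
  · simp [posF, hr]
  · exact (List.pairwise_lt_finRange N).filter _

lemma surv_length {N : ℕ} (D : Fin N → Bool) : (surv D).length = cnt D N := by
  rw [← filter_length_cnt, List.filter_eq_self.2]
  intro a _; simp

lemma z_length {N : ℕ} (Y D f : Fin N → Bool) :
    (applyFlips (applyDel (List.ofFn Y) (List.ofFn D)) (List.ofFn f)).length = (surv D).length := by
  rw [List.ofFn_eq_map, List.ofFn_eq_map, applyDel_map]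
  unfold applyFlips
  have := surv_length_le D
  simp only [surv] at this ⊢
  simp; simpa using this

lemma z_get {N : ℕ} (Y D f : Fin N → Bool) (r : Fin N)
    (hr : (r:ℕ) < (applyFlips (applyDel (List.ofFn Y) (List.ofFn D)) (List.ofFn f)).length) :
    (applyFlips (applyDel (List.ofFn Y) (List.ofFn D)) (List.ofFn f))[(r:ℕ)] =
      xor (Y (posF D r)) (f r) := by
  have hr' := hr
  rw [z_length] at hr'
  have e : applyDel (List.ofFn Y) (List.ofFn D) = (surv D).map Y := by
    rw [List.ofFn_eq_map, List.ofFn_eq_map, applyDel_map]; rfl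
  simp [applyFlips, e, posF, hr']

lemma block_sum {N : ℕ} (z : List Bool) (g : Fin N → Bool) (hz : z.length ≤ N)
    (hg : ∀ r : Fin N, ∀ h : (r:ℕ) < z.length, z[(r:ℕ)] = g r) (a b : ℕ) (hb : b ≤ z.length) :
    (((z.drop a).take (b - a)).map spin).sum =
      ∑ r ∈ univ.filter (fun r : Fin N => a ≤ (r:ℕ) ∧ (r:ℕ) < b), spin (g r) := by
  let h : ℕ → ℝ := fun r => if hr : r < N then spin (g ⟨r, hr⟩) else 0
  have e1 : ((z.drop a).take (b - a)).map spin = (List.range' a (b - a)).map h := by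
    apply List.ext_getElem
    · simp; omega
    · intro k h1 h2
      simp at h1 h2
      have hk : a + k < N := by omega
      have := hg ⟨a + k, hk⟩ (by simp; omega)
      simp only [List.getElem_map, List.getElem_take, List.getElem_drop, List.getElem_range',
        one_mul, h, hk, dif_pos]
      rw [← this]
  rw [e1]
  have e2 : ((List.range' a (b - a)).map h).sum = ∑ k ∈ Finset.Ico a b, h k := rfl
  rw [e2, Finset.sum_filter]
  have e3 : ∀ r : Fin N, (if a ≤ (r:ℕ) ∧ (r:ℕ) < b then spin (g r) else 0) =
      (fun k : ℕ => if a ≤ k ∧ k < b then h k else 0) (r:ℕ) := by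
    intro r; simp [h]
  simp only [e3]
  rw [Fin.sum_univ_eq_sum_range (fun k : ℕ => if a ≤ k ∧ k < b then h k else 0), ← Finset.sum_filter]
  refine Finset.sum_congr ?_ fun _ _ => rfl
  ext k; simp; omega

lemma list_spin_sum (l : List Bool) :
    (l.map spin).sum = 2 * ((l.filter id).length : ℝ) - l.length := by
  induction l with
  | nil => simp
  | cons a l ih => cases a <;> simp [ih, spin] <;> ring

lemma spin_majTie (l : List Bool) (τ : Bool) :
    spin (majTie l τ) = if (l.map spin).sum = 0 then spin τ else sg (l.map spin).sum := by
  rw [list_spin_sum]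
  unfold majTie sg
  rcases lt_trichotomy l.length (2 * (l.filter id).length) with h | h | h
  · have h' : (l.length : ℝ) < 2 * ((l.filter id).length : ℝ) := by exact_mod_cast h
    rw [if_pos h, if_neg (by intro e; linarith), if_pos (by linarith)]; simp [spin]
  · have h' : (l.length : ℝ) = 2 * ((l.filter id).length : ℝ) := by exact_mod_cast h
    rw [if_neg (by omega), if_neg (by omega), if_pos (by linarith)]
  · have h' : 2 * ((l.filter id).length : ℝ) < (l.length : ℝ) := by exact_mod_cast h
    rw [if_neg (by omega), if_pos h, if_neg (by intro e; linarith), if_neg (by linarith),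
      if_pos (by linarith)]; simp [spin]

lemma spin_majVec {m : ℕ} (hm : Odd m) (y : Fin m → Bool) :
    spin (majVec y) = sg (∑ j, spin (y j)) := by
  have e : ∑ j, spin (y j) = 2 * ((univ.filter (fun j => y j = true)).card : ℝ) - m := by
    have h1 : ∀ j, spin (y j) = 2 * (if y j = true then (1:ℝ) else 0) - 1 := by
      intro j; cases y j <;> simp [spin] <;> norm_num
    simp only [h1]
    rw [Finset.sum_sub_distrib, ← Finset.mul_sum]; simp
  rw [e]
  unfold majVec sg
  obtain ⟨k, hk⟩ := hm
  rcases Nat.lt_or_ge m (2 * (univ.filter (fun j => y j = true)).card) with h | h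
  · have h' : (m : ℝ) < 2 * ((univ.filter (fun j => y j = true)).card : ℝ) := by exact_mod_cast h
    rw [if_pos (by linarith)]; simp [spin, h]
  · have h2 : 2 * (univ.filter (fun j => y j = true)).card < m := by omega
    have h' : 2 * ((univ.filter (fun j => y j = true)).card : ℝ) < m := by exact_mod_cast h2
    rw [if_neg (by linarith), if_pos (by linarith)]
    have : ¬ (m < 2 * (univ.filter (fun j => y j = true)).card) := by omega
    simp only [this, decide_false]; simp [spin]

/-- index of bit `j` of block `i` -/
def bix {n m : ℕ} (i : Fin n) (j : Fin m) : Fin (n * m) :=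
  ⟨i * m + j, calc (i:ℕ) * m + j < (i + 1) * m := by rw [Nat.add_mul]; have := j.2; omega
    _ ≤ n * m := Nat.mul_le_mul_right _ i.2⟩

/-- block `i` of `Y` -/
def unflat {n m : ℕ} (Y : Fin (n * m) → Bool) (i : Fin n) (j : Fin m) : Bool := Y (bix i j)

lemma concat_unflat {n m : ℕ} (Y : Fin (n * m) → Bool) :
    concatBlocks n m (unflat Y) = List.ofFn Y := by
  rw [List.ofFn_mul]; rfl

/-- positions of encoder block `i` -/
def encB (n m : ℕ) (i : ℕ) : Finset (Fin (n * m)) :=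
  univ.filter (fun k => i * m ≤ (k:ℕ) ∧ (k:ℕ) < (i + 1) * m)

/-- ranks of decoder block `i` -/
def decB (n m : ℕ) (L : ℕ) (i : ℕ) : Finset (Fin (n * m)) :=
  univ.filter (fun r => i * L / n ≤ (r:ℕ) ∧ (r:ℕ) < (i + 1) * L / n)

lemma encB_eq {n m : ℕ} (i : Fin n) : encB n m i = univ.image (fun j : Fin m => bix i j) := by
  ext k
  simp only [encB, Finset.mem_filter, Finset.mem_univ, true_and, Finset.mem_image]
  constructor
  · rintro ⟨h1, h2⟩
    refine ⟨⟨k - i * m, ?_⟩, ?_⟩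
    · rw [Nat.add_mul] at h2; omega
    · ext; simp only [bix]; omega
  · rintro ⟨j, rfl⟩
    simp only [bix]
    have := j.2
    rw [Nat.add_mul]; omega

lemma bix_inj {n m : ℕ} (i : Fin n) : Function.Injective (fun j : Fin m => bix i j) := by
  intro j j' h
  have := congrArg Fin.val h
  simp only [bix] at this
  ext; omega

lemma encB_card {n m : ℕ} (i : Fin n) : (encB n m i).card = m := by
  rw [encB_eq, Finset.card_image_of_injective _ (bix_inj i)]; simp

lemma spin_majVec_unflat {n m : ℕ} (hm : Odd m) (Y : Fin (n * m) → Bool) (i : Fin n) :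
    spin (majVec (unflat Y i)) = sg (∑ k ∈ encB n m i, spin (Y k)) := by
  rw [spin_majVec hm, encB_eq, Finset.sum_image (fun a _ b _ h => bix_inj i h)]
  rfl

/-- noisy spin sum of decoder block `i` -/
noncomputable def VV {n m : ℕ} (Y D f : Fin (n * m) → Bool) (i : ℕ) : ℝ :=
  ∑ r ∈ decB n m (surv D).length i, spin (xor (Y (posF D r)) (f r))

lemma spin_majDec {n m : ℕ} (Y D f : Fin (n * m) → Bool) (τ : Fin n → Bool) (i : Fin n) :
    spin (majDec n (applyFlips (applyDel (concatBlocks n m (unflat Y)) (List.ofFn D))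
      (List.ofFn f)) τ i) = if VV Y D f i = 0 then spin (τ i) else sg (VV Y D f i) := by
  unfold majDec
  rw [spin_majTie, concat_unflat]
  unfold blockOf
  have hlen := z_length Y D f
  have hle : (i + 1) * (surv D).length / n ≤ (surv D).length := by
    apply Nat.div_le_of_le_mul
    exact Nat.mul_le_mul_right _ i.2
  rw [block_sum (N := n * m) _ (fun r => xor (Y (posF D r)) (f r))
    (by rw [hlen]; exact surv_length_le D) (fun r h => z_get Y D f r h) _ _ (by rw [hlen]; exact hle)]
  rw [hlen]
  rfl

/-! ### Geometry of a good deletion pattern -/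

lemma fin_card_Ico (N lo hi : ℕ) (h : hi ≤ N) :
    (univ.filter (fun r : Fin N => lo ≤ (r:ℕ) ∧ (r:ℕ) < hi)).card = hi - lo := by
  rw [← Nat.card_Ico, ← Finset.card_map Fin.valEmbedding]
  congr 1
  ext k
  simp only [Finset.mem_map, Finset.mem_filter, Finset.mem_univ, true_and, Fin.valEmbedding_apply,
    Finset.mem_Ico]
  constructor
  · rintro ⟨r, hr, rfl⟩; exact hr
  · intro hk; exact ⟨⟨k, by omega⟩, hk, rfl⟩

/-- The survivor counts at block boundaries are close to their means. -/
def GoodD (n m : ℕ) (p : ℝ) (D : Fin (n * m) → Bool) : Prop :=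
  ∀ i ≤ n, |(cnt D (i * m) : ℝ) - (1 - p) * (i * m)| ≤ (1 - p) / 16 * m

section Geom
variable {n m : ℕ} {p : ℝ} {D : Fin (n * m) → Bool}

lemma frac_close (hn : 2 ≤ n) (hg : GoodD n m p D) (i : ℕ) (hi : i ≤ n) :
    |(i * (surv D).length : ℝ) / n - (1 - p) * (i * m)| ≤ (1 - p) / 16 * m := by
  have h := hg n le_rfl
  rw [← surv_length] at h
  have hn0 : (0:ℝ) < n := by exact_mod_cast (by omega : 0 < n)
  have hi' : (i:ℝ) / n ≤ 1 := by rw [div_le_one hn0]; exact_mod_cast hi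
  have hi0 : 0 ≤ (i:ℝ) / n := by positivity
  have e : (i * (surv D).length : ℝ) / n - (1 - p) * (i * m) =
      i / n * ((surv D).length - (1 - p) * (n * m)) := by field_simp
  rw [e, abs_mul, abs_of_nonneg hi0]
  exact (mul_le_of_le_one_left (abs_nonneg _) hi').trans h

lemma div_upper (hn : 2 ≤ n) (hg : GoodD n m p D) (i : ℕ) (hi : i ≤ n) :
    ((i * (surv D).length / n : ℕ) : ℝ) ≤ (1 - p) * (i * m) + (1 - p) / 16 * m := by
  have h := (abs_le.1 (frac_close hn hg i hi)).2
  have := @Nat.cast_div_le ℝ _ _ _ (i * (surv D).length) n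
  push_cast at this
  linarith

lemma div_lower (hn : 2 ≤ n) (hg : GoodD n m p D) (i : ℕ) (hi : i ≤ n) :
    (1 - p) * (i * m) - (1 - p) / 16 * m - 1 ≤ ((i * (surv D).length / n : ℕ) : ℝ) := by
  have h := (abs_le.1 (frac_close hn hg i hi)).1
  have hn0 : (0:ℝ) < n := by exact_mod_cast (by omega : 0 < n)
  have h2 : (i * (surv D).length : ℝ) / n ≤ ((i * (surv D).length / n : ℕ) : ℝ) + 1 := by
    rw [div_le_iff₀ hn0]
    have h3 : i * (surv D).length ≤ (i * (surv D).length / n + 1) * n :=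
      (Nat.lt_mul_of_div_lt (Nat.lt_succ_self _) (by omega)).le
    exact_mod_cast h3
  linarith

lemma dec_le_len (i : ℕ) (hi : i < n) : (i + 1) * (surv D).length / n ≤ (surv D).length := by
  apply Nat.div_le_of_le_mul
  exact Nat.mul_le_mul_right _ hi

lemma mem_decB_lt {i : ℕ} (hi : i < n) {r : Fin (n * m)} (hr : r ∈ decB n m (surv D).length i) :
    (r:ℕ) < (surv D).length := by
  have := (Finset.mem_filter.1 hr).2.2
  exact lt_of_lt_of_le this (dec_le_len i hi)

lemma decB_card (hm : 1 ≤ m) (i : Fin n) : (decB n m (surv D).length i).card ≤ 2 * m := by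
  have hn0 : 0 < n := i.pos
  unfold decB
  rw [fin_card_Ico _ _ _ ((dec_le_len (D := D) i i.2).trans (surv_length_le D))]
  have h1 : ((i:ℕ) + 1) * (surv D).length ≤ (i:ℕ) * (surv D).length + n * m := by
    rw [Nat.add_mul, one_mul]
    have := surv_length_le D; omega
  have h2 : ((i:ℕ) + 1) * (surv D).length / n ≤ (i:ℕ) * (surv D).length / n + m := by
    calc _ ≤ ((i:ℕ) * (surv D).length + n * m) / n := Nat.div_le_div_right h1
      _ = _ := by rw [Nat.add_mul_div_left _ _ hn0]
  omega

lemma overlap (hn : 2 ≤ n) (hp : p < 1) (hm : 8 ≤ (1 - p) * m) (hg : GoodD n m p D) (i : Fin n) :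
    (1 - p) / 2 * m ≤
      ((decB n m (surv D).length i).filter (fun r => posF D r ∈ encB n m i)).card := by
  set L := (surv D).length with hL
  let lo := max ((i:ℕ) * L / n) (cnt D (i * m))
  let hi := min (((i:ℕ) + 1) * L / n) (cnt D ((i + 1) * m))
  have hhi : hi ≤ L := (min_le_left _ _).trans (dec_le_len (D := D) i i.2)
  have hsub : univ.filter (fun r : Fin (n * m) => lo ≤ (r:ℕ) ∧ (r:ℕ) < hi) ⊆
      (decB n m L i).filter (fun r => posF D r ∈ encB n m i) := by
    intro r hr
    obtain ⟨h1, h2⟩ := (Finset.mem_filter.1 hr).2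
    have hrL : (r:ℕ) < (surv D).length := lt_of_lt_of_le h2 hhi
    simp only [Finset.mem_filter, decB, encB, Finset.mem_univ, true_and]
    refine ⟨⟨(le_max_left _ _).trans h1, lt_of_lt_of_le h2 (min_le_left _ _)⟩, ?_, ?_⟩
    · by_contra hc
      push Not at hc
      rw [posF_lt_iff D r hrL] at hc
      have := (le_max_right _ _).trans h1
      omega
    · rw [posF_lt_iff D r hrL]
      exact lt_of_lt_of_le h2 (min_le_right _ _)
  have hcard := Finset.card_le_card hsub
  rw [fin_card_Ico _ _ _ (hhi.trans (surv_length_le D))] at hcard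
  have hcard' : (hi:ℝ) - lo ≤ (((decB n m L i).filter (fun r => posF D r ∈ encB n m i)).card : ℝ) := by
    have : hi ≤ ((decB n m L i).filter (fun r => posF D r ∈ encB n m i)).card + lo := by omega
    have : (hi:ℝ) ≤ (((decB n m L i).filter (fun r => posF D r ∈ encB n m i)).card : ℝ) + lo := by
      exact_mod_cast this
    linarith
  refine le_trans ?_ hcard'
  have a1 := div_upper hn hg i i.2.le
  have a2 := (abs_le.1 (hg i i.2.le)).2
  have a3 := div_lower hn hg (i + 1) i.2
  have a4 := (abs_le.1 (hg (i + 1) i.2)).1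
  push_cast at a3 a4
  have hlo : (lo:ℝ) ≤ (1 - p) * (i * m) + (1 - p) / 16 * m := by
    simp only [lo, Nat.cast_max]
    exact max_le a1 (by linarith)
  have hhi' : (1 - p) * ((i + 1) * m) - (1 - p) / 16 * m - 1 ≤ (hi:ℝ) := by
    simp only [hi, Nat.cast_min]
    exact le_min a3 (by linarith)
  nlinarith

lemma local_dec (hn : 2 ≤ n) (hp : p < 1) (hm : 8 ≤ (1 - p) * m) (hg : GoodD n m p D)
    (i i' : Fin n) (r : Fin (n * m)) (hr : r ∈ decB n m (surv D).length i)
    (h : posF D r ∈ encB n m i') : (i:ℕ) ≤ i' + 1 ∧ (i':ℕ) ≤ i + 1 := by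
  have hrL := mem_decB_lt i.2 hr
  obtain ⟨h1, h2⟩ := (Finset.mem_filter.1 hr).2
  obtain ⟨h3, h4⟩ := (Finset.mem_filter.1 h).2
  constructor
  · by_contra hc
    push Not at hc
    rw [posF_lt_iff D r hrL] at h4
    have a1 := (abs_le.1 (hg (i' + 1) i'.2)).2
    have a2 := div_lower hn hg i i.2.le
    have a3 : (((i:ℕ) * (surv D).length / n : ℕ) : ℝ) ≤ (cnt D ((i' + 1) * m) : ℝ) := by
      exact_mod_cast (h1.trans h4.le)
    have a4 : ((i':ℝ) + 1) + 1 ≤ i := by exact_mod_cast hc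
    have a5 := mul_le_mul_of_nonneg_right a4 (by linarith : 0 ≤ (1 - p) * m)
    push_cast at a1
    nlinarith
  · by_contra hc
    push Not at hc
    have h5 : cnt D (i' * m) ≤ (r:ℕ) := by
      by_contra hc'
      push Not at hc'
      rw [← posF_lt_iff D r hrL] at hc'
      omega
    have a1 := (abs_le.1 (hg i' i'.2.le)).1
    have a2 := div_upper hn hg (i + 1) i.2
    have a3 : (cnt D (i' * m) : ℝ) ≤ ((((i:ℕ) + 1) * (surv D).length / n : ℕ) : ℝ) := by
      exact_mod_cast (h5.trans h2.le)
    have a4 : ((i:ℝ) + 1) + 1 ≤ i' := by exact_mod_cast hc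
    have a5 := mul_le_mul_of_nonneg_right a4 (by linarith : 0 ≤ (1 - p) * m)
    push_cast at a2
    nlinarith

/-- agreement sign of coordinate `i` -/
noncomputable def usgn (hD : Fin (n * m) → Bool) (i : Fin n)
    (ω : Fin (n * m) ⊕ (Fin (n * m) ⊕ Fin n) → Bool) : ℝ :=
  spin (majVec (unflat (fun k => ω (Sum.inl k)) i)) *
    spin (majDec n (applyFlips (applyDel (concatBlocks n m (unflat (fun k => ω (Sum.inl k))))
      (List.ofFn hD)) (List.ofFn (fun r => ω (Sum.inr (Sum.inl r)))))
      (fun j => ω (Sum.inr (Sum.inr j))) i)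

/-- full product weights of encoder bits, noise and tie coins -/
noncomputable def wfull (n m : ℕ) (q : ℝ) : Fin (n * m) ⊕ (Fin (n * m) ⊕ Fin n) → Bool → ℝ :=
  Sum.elim (fun _ => bw (1/2)) (Sum.elim (fun _ => bw q) (fun _ => bw (1/2)))

lemma isPW_wfull (q : ℝ) (h0 : 0 ≤ q) (h1 : q ≤ 1) : IsPW (wfull n m q) :=
  isPW_sumElim isPW_half (isPW_sumElim (isPW_bw q h0 h1) isPW_half)

lemma usgn_pm (i : Fin n) (ω) : usgn D i ω = 1 ∨ usgn D i ω = -1 := by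
  unfold usgn
  generalize majVec _ = a
  generalize majDec _ _ _ _ = b
  cases a <;> cases b <;> simp [spin]

lemma EE_usgn (q : ℝ) (hm : Odd m) (i : Fin n) :
    EE (wfull n m q) (usgn D i) =
    EE (fun _ : Fin (n * m) => bw (1/2)) (fun y => EE (fun _ : Fin (n * m) => bw q) (fun f =>
      sg (∑ k ∈ encB n m i, spin (y k)) *
      sg (∑ r ∈ decB n m (surv D).length i, spin (xor (y (posF D r)) (f r))))) := by
  unfold wfull
  rw [EE_sumElim]
  congr 1; ext y
  rw [EE_sumElim]
  congr 1; ext f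
  unfold usgn
  simp only [Sum.elim_inl, Sum.elim_inr, spin_majVec_unflat hm, spin_majDec]
  rw [EE_smul]
  congr 1
  change EE _ (fun b : Fin n → Bool => if VV y D f i = 0 then spin (b i) else sg (VV y D f i)) =
    sg (VV y D f i)
  by_cases h : VV y D f i = 0
  · simp only [h, if_true]
    rw [EE_marg isPW_half i spin]
    simp [bw, spin, sg]; norm_num
  · simp only [h, if_false]
    exact EE_const isPW_half _

/-- coordinates on which the agreement sign of coordinate `i` depends -/
def depSet (D : Fin (n * m) → Bool) (i : Fin n) : Set (Fin (n * m) ⊕ (Fin (n * m) ⊕ Fin n)) :=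
  {x | (∃ k ∈ encB n m i, x = Sum.inl k) ∨
    (∃ r ∈ decB n m (surv D).length i, x = Sum.inl (posF D r)) ∨
    (∃ r ∈ decB n m (surv D).length i, x = Sum.inr (Sum.inl r)) ∨ x = Sum.inr (Sum.inr i)}

lemma usgn_dep (hm : Odd m) (i : Fin n) : DepOn (depSet D i) (usgn D i) := by
  intro ω ω' h
  unfold usgn
  rw [spin_majVec_unflat hm, spin_majVec_unflat hm, spin_majDec, spin_majDec]
  have e1 : ∑ k ∈ encB n m i, spin (ω (Sum.inl k)) = ∑ k ∈ encB n m i, spin (ω' (Sum.inl k)) :=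
    Finset.sum_congr rfl fun k hk => by rw [h _ (Or.inl ⟨k, hk, rfl⟩)]
  have e2 : VV (fun k => ω (Sum.inl k)) D (fun r => ω (Sum.inr (Sum.inl r))) i =
      VV (fun k => ω' (Sum.inl k)) D (fun r => ω' (Sum.inr (Sum.inl r))) i :=
    Finset.sum_congr rfl fun r hr => by
      beta_reduce
      rw [h _ (Or.inr (Or.inl ⟨r, hr, rfl⟩)), h _ (Or.inr (Or.inr (Or.inl ⟨r, hr, rfl⟩)))]
  rw [e1, e2, h _ (Or.inr (Or.inr (Or.inr rfl)))]

lemma encB_disj (i i' : Fin n) (k) (h : k ∈ encB n m i) (h' : k ∈ encB n m i') : i = i' := by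
  obtain ⟨h1, h2⟩ := (Finset.mem_filter.1 h).2
  obtain ⟨h3, h4⟩ := (Finset.mem_filter.1 h').2
  have a1 := Nat.lt_of_mul_lt_mul_right (lt_of_le_of_lt h1 h4)
  have a2 := Nat.lt_of_mul_lt_mul_right (lt_of_le_of_lt h3 h2)
  ext; omega

lemma decB_disj (L : ℕ) (i i' : Fin n) (r) (h : r ∈ decB n m L i) (h' : r ∈ decB n m L i') :
    i = i' := by
  have key : ∀ i i' : Fin n, r ∈ decB n m L i → r ∈ decB n m L i' → ¬ (i:ℕ) < i' := by
    intro i i' h h' hlt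
    obtain ⟨h1, h2⟩ := (Finset.mem_filter.1 h).2
    obtain ⟨h3, h4⟩ := (Finset.mem_filter.1 h').2
    have : ((i:ℕ) + 1) * L / n ≤ i' * L / n :=
      Nat.div_le_div_right (Nat.mul_le_mul_right _ hlt)
    omega
  have := key i i' h h'
  have := key i' i h' h
  ext; omega

lemma depSet_disj (hn : 2 ≤ n) (hp : p < 1) (hm : 8 ≤ (1 - p) * m) (hg : GoodD n m p D)
    (i i' : Fin n) (hne : i ≠ i') (hpar : (i:ℕ) % 2 = (i':ℕ) % 2) :
    Disjoint (depSet D i) (depSet D i') := by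
  have hne' : (i:ℕ) ≠ i' := fun h => hne (Fin.ext h)
  rw [Set.disjoint_left]
  rintro x (⟨k, hk, rfl⟩ | ⟨r, hr, rfl⟩ | ⟨r, hr, rfl⟩ | rfl) <;>
    rintro (⟨k', hk', h⟩ | ⟨r', hr', h⟩ | ⟨r', hr', h⟩ | h)
  · obtain rfl := Sum.inl.inj h
    exact hne (encB_disj i i' _ hk hk')
  · obtain rfl := Sum.inl.inj h
    have := local_dec hn hp hm hg i' i r' hr' hk
    omega
  · cases h
  · cases h
  · obtain rfl := Sum.inl.inj h
    have := local_dec hn hp hm hg i i' r hr hk'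
    omega
  · have := posF_inj D r r' (mem_decB_lt i.2 hr) (mem_decB_lt i'.2 hr') (Sum.inl.inj h)
    subst this
    exact hne (decB_disj _ i i' _ hr hr')
  · cases h
  · cases h
  · cases h
  · cases h
  · obtain rfl := Sum.inl.inj (Sum.inr.inj h)
    exact hne (decB_disj _ i i' _ hr hr')
  · cases h
  · cases h
  · cases h
  · cases h
  · exact hne (Sum.inr.inj (Sum.inr.inj h))

lemma good_bound (hn : 2 ≤ n) (hp : p < 1) (hmo : Odd m) (hm : 8 ≤ (1 - p) * m)
    (hg : GoodD n m p D) (q s : ℝ) (hq1 : 0 < q) (hq2 : q < 1/2) (hs : 0 < s)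
    (hs2 : 3 * s + 2 ≤ (1 - 2 * q) * ((1 - p) / 2) / 4 * s ^ 2) (hsm : s ^ 2 ≤ m) :
    EE (wfull n m q) (fun ω => if ∑ i, usgn D i ω < Real.exp (-(2 * s ^ 2)) / 2 * n
      then (1:ℝ) else 0) ≤ 2 * Real.exp (-(Real.exp (-(2 * s ^ 2)) ^ 2 / 64 * n)) := by
  have hm0 : 0 < m := hmo.pos
  refine conc (isPW_wfull q hq1.le (by linarith)) n hn (usgn D) usgn_pm _ (Real.exp_pos _)
    (Real.exp_le_one_iff.2 (by nlinarith [sq_nonneg s])) ?_ (depSet D) (usgn_dep hmo)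
    (fun i i' h h' => depSet_disj hn hp hm hg i i' h h')
  intro i
  rw [EE_usgn q hmo i]
  exact corr q ((1 - p) / 2) s hq1 hq2 hs hs2 (posF D) (encB n m i)
    (decB n m (surv D).length i)
    (fun r hr r' hr' h => posF_inj D r r' (mem_decB_lt i.2 hr) (mem_decB_lt i.2 hr') h)
    m (encB_card i).le (decB_card hm0 i) hm0 hsm (by convert overlap hn hp hm hg i)

end Geom

/-! ### Final assembly -/

lemma unflat_bij {n m : ℕ} : Function.Bijective (unflat : (Fin (n * m) → Bool) → Fin n → Fin m → Bool) := by
  have hinj : Function.Injective (unflat : (Fin (n * m) → Bool) → Fin n → Fin m → Bool) := by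
    intro Y Y' h
    ext k
    have hm : 0 < m := by
      rcases Nat.eq_zero_or_pos m with h0 | h0
      · have := k.2; subst h0; simp at this
      · exact h0
    have hk : (k:ℕ) / m < n := by
      rw [Nat.div_lt_iff_lt_mul hm]; exact k.2
    have h1 := congrFun (congrFun h ⟨(k:ℕ) / m, hk⟩) ⟨(k:ℕ) % m, Nat.mod_lt _ hm⟩
    have h2 : bix (⟨(k:ℕ) / m, hk⟩ : Fin n) ⟨(k:ℕ) % m, Nat.mod_lt _ hm⟩ = k := by
      ext; simp only [bix]; exact Nat.div_add_mod' _ _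
    unfold unflat at h1
    rw [h2] at h1
    rw [h1]
  rw [Fintype.bijective_iff_injective_and_card]
  refine ⟨hinj, ?_⟩
  simp only [Fintype.card_pi, Finset.prod_const, Finset.card_univ, Fintype.card_fin,
    Fintype.card_bool]
  rw [← pow_mul, mul_comm]

lemma prod_bw {k : ℕ} (p : ℝ) (v : Fin k → Bool) :
    ∏ j, bw p (v j) = p ^ countT v * (1 - p) ^ (k - countT v) := by
  unfold bw countT
  rw [Finset.prod_ite, Finset.prod_const, Finset.prod_const]
  congr 2
  have := Finset.card_filter_add_card_filter_not (s := (univ : Finset (Fin k)))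
    (fun j => v j = true)
  simp only [Finset.card_univ, Fintype.card_fin] at this
  omega

lemma EE_fin {k : ℕ} (w : Fin k → Bool → ℝ) (F : (Fin k → Bool) → ℝ) :
    EE w F = ∑ ω : Fin k → Bool, (∏ j, w j (ω j)) * F ω := by
  unfold EE
  exact Finset.sum_congr (by ext; simp) fun _ _ => rfl

lemma prod_half {k : ℕ} (v : Fin k → Bool) : ∏ j, bw (1/2) (v j) = (1/2:ℝ) ^ k := by
  have : ∀ b, bw (1/2) b = 1/2 := by intro b; cases b <;> norm_num [bw]
  rw [Finset.prod_congr rfl fun j _ => this (v j), Finset.prod_const, Finset.card_univ,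
    Fintype.card_fin]

lemma lhs_eq {n m : ℕ} (hm : 0 < m) (p q : ℝ)
    (G : (Fin n → Bool) → (Fin n → Fin m → Bool) → (Fin (n * m) → Bool) →
      (Fin (n * m) → Bool) → (Fin n → Bool) → ℝ) :
    ∑ x : Fin n → Bool, ∑ y : Fin n → Fin m → Bool,
      ∑ D : Fin (n * m) → Bool, ∑ f : Fin (n * m) → Bool, ∑ τ : Fin n → Bool,
        ((1 / 2 ^ n : ℝ) *
          (if ∀ i, majVec (y i) = x i then ((1 / 2 ^ (m - 1) : ℝ)) ^ n else 0) *
          (p ^ countT D * (1 - p) ^ (n * m - countT D)) *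
          (q ^ countT f * (1 - q) ^ (n * m - countT f)) *
          (1 / 2 ^ n : ℝ)) * G x y D f τ =
    EE (fun _ : Fin (n * m) => bw p) (fun D => EE (wfull n m q) (fun ω =>
      G (fun i => majVec (unflat (fun k => ω (Sum.inl k)) i)) (unflat (fun k => ω (Sum.inl k))) D
        (fun r => ω (Sum.inr (Sum.inl r))) (fun j => ω (Sum.inr (Sum.inr j))))) := by
  unfold wfull
  simp only [EE_sumElim, Sum.elim_inl, Sum.elim_inr]
  rw [EE_comm]
  simp only [EE_fin, prod_half]
  rw [Finset.sum_comm]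
  refine ((Fintype.sum_bijective unflat unflat_bij _ _ fun Y => ?_).symm)
  rw [Finset.sum_eq_single (fun i => majVec (unflat Y i))]
  · have hw : (1/2:ℝ) ^ (n * m) = (1 / 2 ^ n : ℝ) * (1 / 2 ^ (m - 1) : ℝ) ^ n := by
      obtain ⟨k, rfl⟩ : ∃ k, m = k + 1 := ⟨m - 1, by omega⟩
      simp only [Nat.add_sub_cancel, one_div, inv_pow]
      rw [← mul_inv, ← pow_mul, ← pow_add]
      congr 2; ring
    rw [if_pos (fun _ => rfl), ← hw]
    simp only [Finset.mul_sum, prod_bw]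
    refine Finset.sum_congr rfl fun D _ => Finset.sum_congr rfl fun f _ =>
      Finset.sum_congr rfl fun τ _ => ?_
    rw [one_div_pow (2:ℝ) n]
    ring
  · intro x _ hx
    have : ¬ ∀ i, majVec (unflat Y i) = x i := fun h => hx (funext fun i => (h i).symm)
    simp [this]
  · simp

lemma sum_usgn {n m : ℕ} (D : Fin (n * m) → Bool)
    (ω : Fin (n * m) ⊕ (Fin (n * m) ⊕ Fin n) → Bool) :
    ∑ i, usgn D i ω = n - 2 * ((univ.filter (fun i : Fin n =>
      majVec (unflat (fun k => ω (Sum.inl k)) i) ≠ majDec n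
        (applyFlips (applyDel (concatBlocks n m (unflat (fun k => ω (Sum.inl k))))
          (List.ofFn D)) (List.ofFn (fun r => ω (Sum.inr (Sum.inl r)))))
        (fun j => ω (Sum.inr (Sum.inr j))) i)).card : ℝ) := by
  have key : ∀ i : Fin n, usgn D i ω = 1 - 2 * (if majVec (unflat (fun k => ω (Sum.inl k)) i) ≠ majDec n
        (applyFlips (applyDel (concatBlocks n m (unflat (fun k => ω (Sum.inl k))))
          (List.ofFn D)) (List.ofFn (fun r => ω (Sum.inr (Sum.inl r)))))
        (fun j => ω (Sum.inr (Sum.inr j))) i then (1:ℝ) else 0) := by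
    intro i
    unfold usgn
    generalize majVec _ = a
    generalize majDec _ _ _ _ = b
    cases a <;> cases b <;> norm_num [spin]
  rw [Finset.sum_congr rfl fun i _ => key i, Finset.sum_sub_distrib, ← Finset.mul_sum,
    Finset.sum_boole]
  simp

lemma negl_aux (f : ℕ → ℝ) (h : ∀ k : ℕ, Filter.Tendsto (fun n : ℕ => (n:ℝ)^k * f n)
    Filter.atTop (nhds 0)) : Negligible f := by
  intro k
  have h1 := ((h k).eventually (gt_mem_nhds (zero_lt_one))).and (Filter.eventually_ge_atTop 1)
  obtain ⟨N, hN⟩ := Filter.eventually_atTop.1 h1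
  refine ⟨N, fun n hn => ?_⟩
  obtain ⟨h2, h3⟩ := hN n hn
  have : (0:ℝ) < (n:ℝ)^k := by
    have : (0:ℝ) < n := by exact_mod_cast h3
    positivity
  rw [le_div_iff₀ this, mul_comm]
  exact h2.le

lemma tend_exp (c : ℝ) (hc : 0 < c) (k : ℕ) :
    Filter.Tendsto (fun n : ℕ => (n:ℝ)^k * Real.exp (-(c * n))) Filter.atTop (nhds 0) := by
  have h := (Real.tendsto_pow_mul_exp_neg_atTop_nhds_zero k).comp
    ((tendsto_natCast_atTop_atTop (R := ℝ)).const_mul_atTop hc)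
  have h2 := h.const_mul ((1/c)^k)
  rw [mul_zero] at h2
  refine h2.congr fun n => ?_
  simp only [Function.comp]
  rw [← mul_assoc, ← mul_pow]
  congr 2
  field_simp

lemma tend_log (k : ℕ) :
    Filter.Tendsto (fun n : ℕ => (n:ℝ)^k * Real.exp (-(Real.log n)^2)) Filter.atTop (nhds 0) := by
  have h0 : Filter.Tendsto (fun x : ℝ => -(x * (x - k))) Filter.atTop Filter.atBot := by
    refine Filter.tendsto_neg_atTop_atBot.comp ?_
    refine Filter.Tendsto.atTop_mul_atTop₀ Filter.tendsto_id ?_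
    exact Filter.tendsto_atTop_add_const_right _ (-(k:ℝ)) Filter.tendsto_id
  have h1 := Real.tendsto_exp_atBot.comp (h0.comp
    (Real.tendsto_log_atTop.comp (tendsto_natCast_atTop_atTop (R := ℝ))))
  refine h1.congr' ?_
  filter_upwards [Filter.eventually_ge_atTop 1] with n hn
  have hn' : (0:ℝ) < n := by exact_mod_cast hn
  simp only [Function.comp]
  rw [show (n:ℝ)^k = Real.exp (k * Real.log n) by
    rw [Real.exp_nat_mul, Real.exp_log hn'], ← Real.exp_add]
  congr 1; ring

lemma negl_nu (c : ℝ) (hc : 0 < c) : Negligible (fun n : ℕ =>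
    2 * (n + 1) * Real.exp (-(Real.log n)^2) + 2 * Real.exp (-(c * n))) := by
  apply negl_aux
  intro k
  have h := (((tend_log (k+1)).const_mul 2).add ((tend_log k).const_mul 2)).add
    ((tend_exp c hc k).const_mul 2)
  simp only [mul_zero, add_zero] at h
  refine h.congr fun n => ?_
  ring

lemma main_bound {n m : ℕ} (hn : 2 ≤ n) (hmo : Odd m) (p q s : ℝ) (hp1 : 0 < p) (hp2 : p < 1)
    (hq1 : 0 < q) (hq2 : q < 1/2) (hm : 8 ≤ (1 - p) * m) (hs : 0 < s)
    (hs2 : 3 * s + 2 ≤ (1 - 2 * q) * ((1 - p) / 2) / 4 * s ^ 2) (hsm : s ^ 2 ≤ m) :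
    EE (fun _ : Fin (n * m) => bw p) (fun D => EE (wfull n m q) (fun ω =>
      if ∑ i, usgn D i ω < Real.exp (-(2 * s ^ 2)) / 2 * n then (1:ℝ) else 0)) ≤
    2 * (n + 1) * Real.exp (-(((1 - p)/16)^2 / 4 * (m / n))) +
      2 * Real.exp (-(Real.exp (-(2 * s ^ 2)) ^ 2 / 64 * n)) := by
  have hw : IsPW (fun _ : Fin (n*m) => bw p) := isPW_bw p hp1.le hp2.le
  have hb := bad_bound n m hn p hp1 hp2 ((1-p)/16) (by linarith) (by linarith)
  refine le_trans (EE_mono hw (G := fun D =>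
      (if ∀ i ≤ n, |(cnt D (i * m) : ℝ) - (1 - p) * (i * m)| ≤ (1-p)/16 * m then (0:ℝ) else 1)
      + 2 * Real.exp (-(Real.exp (-(2 * s ^ 2)) ^ 2 / 64 * n))) ?_) ?_
  · intro D
    by_cases hg : GoodD n m p D
    · have hg2 := hg
      unfold GoodD at hg2
      rw [if_pos hg2, zero_add]
      exact good_bound hn hp2 hmo hm hg q s hq1 hq2 hs hs2 hsm
    · unfold GoodD at hg
      rw [if_neg hg]
      have hw2 := isPW_wfull (n := n) (m := m) q hq1.le (by linarith)
      have h1 : EE (wfull n m q) (fun ω =>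
        if ∑ i, usgn D i ω < Real.exp (-(2 * s ^ 2)) / 2 * n then (1:ℝ) else 0) ≤
          EE (wfull n m q) (fun _ => 1) := EE_mono hw2 fun ω => by split_ifs <;> norm_num
      rw [EE_const hw2] at h1
      have := Real.exp_pos (-(Real.exp (-(2 * s ^ 2)) ^ 2 / 64 * n))
      linarith
  · rw [EE_add, EE_const hw]
    linarith

/-- For all constants `p ∈ (0,1)` and `q ∈ (0,1/2)` there exist `ε > 0`,
`C > 0` and a negligible `ν` such that for all `n ≥ 2` and all odd `m ≥ C·n·(log n)⁶`:
the probability, over a uniform `x ∈ {0,1}ⁿ` and the internal randomness (the random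
majority-encoding `y` with `Maj(yⁱ) = xᵢ`, the deletion flags `D` of `BDC_p`, the flip
flags `f` of `BSC_q`, and the tie-break coins `τ` of `MajDec`), that
`wt(x ⊕ MajDec_n(BSC_q(BDC_p(MajEnc_m(x))))) > (1/2 − ε)·n` is at most `ν n`.
(For odd `m`, a uniform draw from `{y : Maj(y) = xᵢ}` has mass `1/2^{m−1}` on each
matching block, which is the weight used below.) -/
theorem stmt_13 (p q : ℝ) (hp1 : 0 < p) (hp2 : p < 1) (hq1 : 0 < q) (hq2 : q < 1/2) :
    ∃ ε : ℝ, 0 < ε ∧ ∃ C : ℝ, 0 < C ∧ ∃ ν : ℕ → ℝ, Negligible ν ∧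
      ∀ n : ℕ, 2 ≤ n → ∀ m : ℕ, Odd m → C * (n : ℝ) * (Real.logb 2 n) ^ 6 ≤ (m : ℝ) →
        ∑ x : Fin n → Bool, ∑ y : Fin n → Fin m → Bool,
          ∑ D : Fin (n * m) → Bool, ∑ f : Fin (n * m) → Bool, ∑ τ : Fin n → Bool,
            ((1 / 2 ^ n : ℝ) *
              (if ∀ i, majVec (y i) = x i then ((1 / 2 ^ (m - 1) : ℝ)) ^ n else 0) *
              (p ^ countT D * (1 - p) ^ (n * m - countT D)) *
              (q ^ countT f * (1 - q) ^ (n * m - countT f)) *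
              (1 / 2 ^ n : ℝ)) *
            (if ((1/2 : ℝ) - ε) * (n : ℝ) <
                ((univ.filter (fun i : Fin n =>
                  x i ≠ majDec n
                    (applyFlips (applyDel (concatBlocks n m y) (List.ofFn D)) (List.ofFn f))
                    τ i)).card : ℝ)
             then 1 else 0)
        ≤ ν n := by
  set κ : ℝ := (1 - 2 * q) * ((1 - p) / 2) / 4 with hκ
  have hp3 : 0 < 1 - p := by linarith
  have hκ0 : 0 < κ := by
    have : 0 < 1 - 2 * q := by linarith
    positivity
  set s : ℝ := 3 / κ + 2 with hsdef
  have hs0 : 0 < s := by positivity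
  have hκ1 : κ ≤ 1 := by
    rw [hκ]; nlinarith
  have hs2 : 3 * s + 2 ≤ κ * s ^ 2 := by
    have e : κ * s = 3 + 2 * κ := by rw [hsdef]; field_simp
    have e2 : κ * s ^ 2 = (3 + 2 * κ) * s := by rw [← e]; ring
    rw [e2]
    have : 2 * κ * s = 2 * (3 + 2 * κ) := by rw [← e]; ring
    nlinarith
  set δ : ℝ := Real.exp (-(2 * s ^ 2)) with hδ
  have hδ0 : 0 < δ := Real.exp_pos _
  set a : ℝ := (1 - p) / 16 with ha
  have ha0 : 0 < a := by positivity
  set C : ℝ := s ^ 2 + 8 / (1 - p) + 4 / a ^ 2 with hC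
  have hC0 : 0 < C := by positivity
  refine ⟨δ / 4, by positivity, C, hC0, _, negl_nu (δ ^ 2 / 64) (by positivity), ?_⟩
  intro n hn m hmo hmC
  have hn' : (2:ℝ) ≤ n := by exact_mod_cast hn
  have hL1 : 1 ≤ Real.logb 2 n := by
    rw [Real.le_logb_iff_rpow_le (by norm_num) (by linarith)]; simpa using hn'
  have hlog0 : 0 ≤ Real.log n := Real.log_nonneg (by linarith)
  have hL2 : Real.log n ≤ Real.logb 2 n := by
    unfold Real.logb
    have h2 : 0 < Real.log 2 := Real.log_pos (by norm_num)
    rw [le_div_iff₀ h2]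
    have : Real.log 2 ≤ 1 := by have := Real.log_two_lt_d9; linarith
    nlinarith
  have hL6 : (Real.log n) ^ 2 ≤ (Real.logb 2 n) ^ 6 :=
    (pow_le_pow_left₀ hlog0 hL2 2).trans (pow_le_pow_right₀ hL1 (by norm_num))
  have hL61 : 1 ≤ (Real.logb 2 n) ^ 6 := one_le_pow₀ hL1
  have hCm : C ≤ m := by
    have h1 : C * 1 ≤ C * n := mul_le_mul_of_nonneg_left (by linarith) hC0.le
    have h2 : C * n * 1 ≤ C * n * (Real.logb 2 n) ^ 6 :=
      mul_le_mul_of_nonneg_left hL61 (by positivity)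
    linarith
  have h8 : 0 < 8 / (1 - p) := by positivity
  have h4 : 0 < 4 / a ^ 2 := by positivity
  have hsm : s ^ 2 ≤ m := by linarith
  have hm8 : 8 ≤ (1 - p) * m := by
    have : 8 / (1 - p) ≤ m := by nlinarith [sq_nonneg s]
    rw [div_le_iff₀ hp3] at this
    linarith
  have hmn : (Real.log n) ^ 2 ≤ a ^ 2 / 4 * (m / n) := by
    have h1 : C * (Real.logb 2 n) ^ 6 ≤ m / n := by
      rw [le_div_iff₀ (by linarith)]; linarith
    have h2 : 4 / a ^ 2 * (Real.log n) ^ 2 ≤ C * (Real.logb 2 n) ^ 6 :=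
      mul_le_mul (by nlinarith [sq_nonneg s]) hL6 (sq_nonneg _) hC0.le
    calc (Real.log n) ^ 2 = a ^ 2 / 4 * (4 / a ^ 2 * (Real.log n) ^ 2) := by field_simp
      _ ≤ _ := mul_le_mul_of_nonneg_left (h2.trans h1) (by positivity)
  have hmain := main_bound hn hmo p q s hp1 hp2 hq1 hq2 hm8 hs0 hs2 hsm
  have hexp : Real.exp (-(a ^ 2 / 4 * (m / n))) ≤ Real.exp (-(Real.log n) ^ 2) :=
    Real.exp_le_exp.2 (neg_le_neg hmn)
  have hfin : 2 * ((n:ℝ) + 1) * Real.exp (-(a ^ 2 / 4 * (m / n))) ≤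
      2 * (n + 1) * Real.exp (-(Real.log n) ^ 2) :=
    mul_le_mul_of_nonneg_left hexp (by positivity)
  rw [lhs_eq hmo.pos p q (fun x y D f τ => if ((1/2 : ℝ) - δ / 4) * (n : ℝ) <
                ((univ.filter (fun i : Fin n =>
                  x i ≠ majDec n
                    (applyFlips (applyDel (concatBlocks n m y) (List.ofFn D)) (List.ofFn f))
                    τ i)).card : ℝ)
             then 1 else 0)]
  refine le_trans (le_of_eq ?_) (hmain.trans (by linarith))
  congr 1; funext D
  congr 1; funext ω
  rw [sum_usgn D ω]
  refine if_congr ?_ rfl rfl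
  constructor <;> intro h <;> linarith
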